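/- Let n ≥ 2 and let A(s), B(s) ∈ F[s]^{n×n} be regular pencils with homogeneous invariant factors φ₁ | ⋯ | φ_n and ψ₁ | ⋯ | ψ_n, and assume F ∪ {∞} is not contained in Λ(A(s)) ∪ Λ(B(s)). Define r₀ = min{ r ≥ 0 : φ_{i−r}(s,t) | ψ_i(s,t) | φ_{i+r}(s,t) for all 1 ≤ i ≤ n }. Then there exists a pencil P(s) ∈ F[s]^{n×n} of normal rank exactly r with A(s) + P(s) strictly equivalent to B(s) if and only if r₀ ≤ r ≤ n. -/

import Mathlib

/-- A polynomial matrix is a (matrix) pencil if every entry has degree at most 1. -/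
def IsPencil {F : Type*} [Field F] {m n : ℕ} (M : Matrix (Fin m) (Fin n) (Polynomial F)) : Prop :=
  ∀ i j, (M i j).degree ≤ 1

/-- Normal rank of a polynomial matrix: its rank over the field of rational functions. -/
noncomputable def normalRank {F : Type*} [Field F] {m n : ℕ}
    (M : Matrix (Fin m) (Fin n) (Polynomial F)) : ℕ :=
  (M.map (algebraMap (Polynomial F) (RatFunc F))).rank

/-- Strict equivalence of polynomial matrices (pencils):
`G = Q * H * R` for invertible constant matrices `Q`, `R`. -/
def StrictEquiv {F : Type*} [Field F] {m n : ℕ}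
    (G H : Matrix (Fin m) (Fin n) (Polynomial F)) : Prop :=
  ∃ (Q : Matrix (Fin m) (Fin m) F) (R : Matrix (Fin n) (Fin n) F),
    IsUnit Q.det ∧ IsUnit R.det ∧ G = (Q.map Polynomial.C) * H * (R.map Polynomial.C)

/-- The pencil `G₀ + s G₁` as a polynomial matrix. -/
noncomputable def pencilOf {F : Type*} [Field F] {m n : ℕ}
    (G₀ G₁ : Matrix (Fin m) (Fin n) F) : Matrix (Fin m) (Fin n) (Polynomial F) :=
  G₀.map Polynomial.C + (Polynomial.X : Polynomial F) • G₁.map Polynomial.C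

/-- The homogeneous pencil `t G₀ + s G₁` (variables `s = X 0`, `t = X 1`). -/
noncomputable def homPencil {F : Type*} [Field F] {m n : ℕ}
    (G₀ G₁ : Matrix (Fin m) (Fin n) F) : Matrix (Fin m) (Fin n) (MvPolynomial (Fin 2) F) :=
  (MvPolynomial.X 1 : MvPolynomial (Fin 2) F) • G₀.map MvPolynomial.C +
    (MvPolynomial.X 0 : MvPolynomial (Fin 2) F) • G₁.map MvPolynomial.C

/-- The set of `k × k` minors of a matrix. -/
def minorsSet {R : Type*} [CommRing R] {m n : ℕ} (M : Matrix (Fin m) (Fin n) R) (k : ℕ) :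
    Set R :=
  { d | ∃ (ri : Fin k → Fin m) (ci : Fin k → Fin n),
      Function.Injective ri ∧ Function.Injective ci ∧ d = (M.submatrix ri ci).det }

/-- `g` is a greatest common divisor of the set `S`. -/
def IsGCDOf {R : Type*} [CommRing R] (g : R) (S : Set R) : Prop :=
  (∀ x ∈ S, g ∣ x) ∧ ∀ d : R, (∀ x ∈ S, d ∣ x) → d ∣ g

/-- `φ 0, …, φ (n-1)` are homogeneous invariant factors (up to units) of the pencil
`G₀ + s G₁`: for each `k ≤ n` the product of the first `k` of them is a gcd of the
`k × k` minors of the homogeneous pencil `t G₀ + s G₁`. -/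
def IsHomogeneousIF {F : Type*} [Field F] {n : ℕ} (G₀ G₁ : Matrix (Fin n) (Fin n) F)
    (φ : ℕ → MvPolynomial (Fin 2) F) : Prop :=
  ∀ k : ℕ, k ≤ n → IsGCDOf (∏ i ∈ Finset.range k, φ i) (minorsSet (homPencil G₀ G₁) k)

/-- Extension of a finite family of invariant factors (indexed `1, …, n`, stored with
offset `1` so that `φ 0` is the first one) to all integer indices, with the convention
that it is `1` below the range and `0` above it. -/
def extIF {R : Type*} [CommRing R] (n : ℕ) (φ : ℕ → R) : ℤ → R :=
  fun j => if j < 1 then 1 else if (n : ℤ) < j then 0 else φ (j - 1).toNat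

/-- Interlacing condition `φ_{i-r} ∣ ψ_i ∣ φ_{i+r}`, `1 ≤ i ≤ n`. -/
def Interlace {R : Type*} [CommRing R] (n r : ℕ) (φ ψ : ℕ → R) : Prop :=
  ∀ i : ℕ, 1 ≤ i → i ≤ n →
    extIF n φ ((i : ℤ) - r) ∣ extIF n ψ (i : ℤ) ∧
      extIF n ψ (i : ℤ) ∣ extIF n φ ((i : ℤ) + r)

/-- The operation `P_X` on pencils, acting on the pair `(G₀, G₁)` of coefficients of
`G(s) = G₀ + s G₁`: for `X = [[x, y], [z, w]]`,
`P_X(s G₁ + G₀) = s (x G₁ + z G₀) + (y G₁ + w G₀)`. -/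
def mapP {F : Type*} [Field F] {m n : ℕ} (X : Matrix (Fin 2) (Fin 2) F)
    (G : Matrix (Fin m) (Fin n) F × Matrix (Fin m) (Fin n) F) :
    Matrix (Fin m) (Fin n) F × Matrix (Fin m) (Fin n) F :=
  (X 0 1 • G.2 + X 1 1 • G.1, X 0 0 • G.2 + X 1 0 • G.1)

/-- The substitution `Π_X(Φ)(s, t) = Φ(s x + t y, s z + t w)` for `X = [[x, y], [z, w]]`. -/
noncomputable def PiX {F : Type*} [Field F] (X : Matrix (Fin 2) (Fin 2) F)
    (Φ : MvPolynomial (Fin 2) F) : MvPolynomial (Fin 2) F :=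
  MvPolynomial.aeval
    ![MvPolynomial.C (X 0 0) * MvPolynomial.X 0 + MvPolynomial.C (X 0 1) * MvPolynomial.X 1,
      MvPolynomial.C (X 1 0) * MvPolynomial.X 0 + MvPolynomial.C (X 1 1) * MvPolynomial.X 1] Φ

/-- The homogeneous invariant factor of a nonzero `1 × 1` pencil `a(s) = a₀ + s a₁`:
the homogenization `t a₀ + s a₁`, made monic with respect to `s`
(equal to `t` when `a₁ = 0`). -/
noncomputable def homIF1 {F : Type*} [Field F] (a : Polynomial F) : MvPolynomial (Fin 2) F :=
  MvPolynomial.C (a.leadingCoeff)⁻¹ *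
    (MvPolynomial.C (a.coeff 1) * MvPolynomial.X 0 + MvPolynomial.C (a.coeff 0) * MvPolynomial.X 1)

/-- The homogeneous pencil associated to a polynomial matrix pencil. -/
noncomputable def homOf {F : Type*} [Field F] {n : ℕ}
    (M : Matrix (Fin n) (Fin n) (Polynomial F)) : Matrix (Fin n) (Fin n) (MvPolynomial (Fin 2) F) :=
  homPencil (M.map fun p => p.coeff 0) (M.map fun p => p.coeff 1)

namespace PencilPerturbation

open Polynomial Matrix

section Smith

variable {R : Type*} [CommRing R] {n : ℕ}

/-- Equivalence of square matrices over a commutative ring. -/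
def MatEquiv (M N : Matrix (Fin n) (Fin n) R) : Prop :=
  ∃ U V : Matrix (Fin n) (Fin n) R, IsUnit U.det ∧ IsUnit V.det ∧ U * M * V = N

theorem MatEquiv.refl (M : Matrix (Fin n) (Fin n) R) : MatEquiv M M :=
  ⟨1, 1, by simp, by simp, by simp⟩

theorem MatEquiv.trans {M N L : Matrix (Fin n) (Fin n) R} (h₁ : MatEquiv M N)
    (h₂ : MatEquiv N L) : MatEquiv M L := by
  obtain ⟨U, V, hU, hV, rfl⟩ := h₁
  obtain ⟨U', V', hU', hV', rfl⟩ := h₂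
  refine ⟨U' * U, V * V', ?_, ?_, ?_⟩
  · rw [det_mul]; exact hU'.mul hU
  · rw [det_mul]; exact hV.mul hV'
  · simp only [Matrix.mul_assoc]

theorem MatEquiv.transpose {M N : Matrix (Fin n) (Fin n) R} (h : MatEquiv M N) :
    MatEquiv Mᵀ Nᵀ := by
  obtain ⟨U, V, hU, hV, rfl⟩ := h
  exact ⟨Vᵀ, Uᵀ, by rwa [det_transpose], by rwa [det_transpose], by
    simp only [transpose_mul, Matrix.mul_assoc]⟩

theorem MatEquiv.submatrix (M : Matrix (Fin n) (Fin n) R) (σ τ : Equiv.Perm (Fin n)) :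
    MatEquiv M (M.submatrix σ τ) := by
  refine ⟨σ.toPEquiv.toMatrix, τ.symm.toPEquiv.toMatrix, ?_, ?_, ?_⟩
  · rw [det_permutation]
    exact (Int.isUnit_iff.2 (Int.units_eq_one_or (Equiv.Perm.sign σ) |>.imp (by simp +contextual)
      (by simp +contextual))).map (Int.castRingHom R)
  · rw [det_permutation]
    exact (Int.isUnit_iff.2 (Int.units_eq_one_or (Equiv.Perm.sign τ.symm) |>.imp
      (by simp +contextual) (by simp +contextual))).map (Int.castRingHom R)
  · rw [PEquiv.toMatrix_toPEquiv_mul, PEquiv.mul_toMatrix_toPEquiv]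
    simp

/-- Adding multiples `c i` of row `k` to all the other rows. -/
theorem MatEquiv.addRows (M : Matrix (Fin n) (Fin n) R) (k : Fin n) (c : Fin n → R)
    (hc : c k = 0) : MatEquiv M (Matrix.of fun i j => M i j + c i * M k j) := by
  refine ⟨1 + vecMulVec c (Pi.single k 1), 1, ?_, by simp, ?_⟩
  · refine isUnit_det_of_right_inverse (B := 1 - vecMulVec c (Pi.single k 1)) ?_
    have : vecMulVec c (Pi.single k 1) * vecMulVec c (Pi.single k 1) = 0 := by
      rw [vecMulVec_mul_vecMulVec]; simp [hc]
    noncomm_ring [this]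
  · ext i j
    simp [add_mul, vecMulVec_mul, vecMulVec_apply]

end Smith

section SmithField

variable {F : Type*} [Field F] {n : ℕ}

/-- `a` is a nonzero value of minimal degree among the entries of matrices equivalent to `M`. -/
def IsMinEntry (M : Matrix (Fin n) (Fin n) F[X]) (a : F[X]) : Prop :=
  a ≠ 0 ∧ ∀ N, MatEquiv M N → ∀ i j, N i j ≠ 0 → a.natDegree ≤ (N i j).natDegree

theorem IsMinEntry.of_equiv {M N : Matrix (Fin n) (Fin n) F[X]} {a : F[X]}
    (h : IsMinEntry M a) (hMN : MatEquiv M N) : IsMinEntry N a :=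
  ⟨h.1, fun L hL => h.2 L (hMN.trans hL)⟩

theorem IsMinEntry.transpose {M : Matrix (Fin n) (Fin n) F[X]} {a : F[X]}
    (h : IsMinEntry M a) : IsMinEntry Mᵀ a :=
  ⟨h.1, fun N hN i j => h.2 Nᵀ (by simpa using hN.transpose) j i⟩

theorem IsMinEntry.dvd_col {M : Matrix (Fin n) (Fin n) F[X]} {k l : Fin n}
    (h : IsMinEntry M (M k l)) (i : Fin n) : M k l ∣ M i l := by
  classical
  by_cases hik : i = k
  · rw [hik]
  rw [← EuclideanDomain.mod_eq_zero]
  by_contra hr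
  have h1 := h.2 _ (MatEquiv.addRows M k (Pi.single i (-(M i l / M k l)))
    (by simp [Ne.symm hik])) i l
  have h2 : M i l + -(M i l / M k l) * M k l = M i l % M k l := by
    rw [EuclideanDomain.mod_eq_sub_mul_div]; ring
  simp only [of_apply, Pi.single_eq_same, h2] at h1
  have h3 := h1 hr
  have h4 := natDegree_lt_natDegree hr (EuclideanDomain.mod_lt (M i l) h.1)
  omega

theorem IsMinEntry.dvd_row {M : Matrix (Fin n) (Fin n) F[X]} {k l : Fin n}
    (h : IsMinEntry M (M k l)) (j : Fin n) : M k l ∣ M k j :=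
  IsMinEntry.dvd_col (M := Mᵀ) (k := l) (l := k) h.transpose j

theorem exists_clear_col {M : Matrix (Fin n) (Fin n) F[X]} {k l : Fin n}
    (h : IsMinEntry M (M k l)) : ∃ N, MatEquiv M N ∧ N k l = M k l ∧ (∀ i, i ≠ k → N i l = 0) ∧
      ((∀ j, j ≠ l → M k j = 0) → ∀ j, j ≠ l → N k j = 0) := by
  classical
  refine ⟨_, MatEquiv.addRows M k (fun i => if i = k then 0 else -(M i l / M k l)) (by simp),
    by simp, fun i hi => ?_, fun hj j hjl => by simp [hj j hjl]⟩
  have h2 : M i l + -(M i l / M k l) * M k l = M i l % M k l := by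
    rw [EuclideanDomain.mod_eq_sub_mul_div]; ring
  simp only [of_apply, hi, if_false, h2]
  exact EuclideanDomain.mod_eq_zero.2 (h.dvd_col i)

/-- One step of the reduction to Smith normal form. -/
theorem exists_smith_step (M : Matrix (Fin (n + 1)) (Fin (n + 1)) F[X]) :
    ∃ N, MatEquiv M N ∧ (∀ i, i ≠ 0 → N i 0 = 0) ∧ (∀ j, j ≠ 0 → N 0 j = 0) ∧
      ∀ i j, N 0 0 ∣ N i j := by
  classical
  by_cases hM : M = 0
  · exact ⟨M, .refl M, by simp [hM], by simp [hM], by simp [hM]⟩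
  obtain ⟨i₀, j₀, h₀⟩ : ∃ i j, M i j ≠ 0 := by
    by_contra! h; exact hM (Matrix.ext h)
  let S : Set ℕ := {d | ∃ N, MatEquiv M N ∧ ∃ i j, N i j ≠ 0 ∧ (N i j).natDegree = d}
  have hS : S.Nonempty := ⟨_, M, .refl M, i₀, j₀, h₀, rfl⟩
  obtain ⟨N, hN, i, j, hij, hd⟩ := Nat.sInf_mem hS
  have hmin : IsMinEntry M (N i j) := ⟨hij, fun L hL a b hab => by
    rw [hd]; exact Nat.sInf_le ⟨L, hL, a, b, hab, rfl⟩⟩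
  let N₀ := N.submatrix (Equiv.swap 0 i) (Equiv.swap 0 j)
  have e₀ : MatEquiv M N₀ := hN.trans (.submatrix N _ _)
  have h00 : N₀ 0 0 = N i j := by simp [N₀]
  have m₀ : IsMinEntry N₀ (N₀ 0 0) := h00 ▸ hmin.of_equiv e₀
  obtain ⟨N₁, e₁, v₁, c₁, -⟩ := exists_clear_col m₀
  have m₁ : IsMinEntry N₁ (N₁ 0 0) := v₁ ▸ m₀.of_equiv e₁
  obtain ⟨N₂, e₂, v₂, c₂, r₂⟩ := exists_clear_col (M := N₁ᵀ) (k := 0) (l := 0) m₁.transpose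
  have e₃ : MatEquiv N₁ N₂ᵀ := by simpa using e₂.transpose
  have m₂ : IsMinEntry N₂ᵀ (N₂ᵀ 0 0) := by
    have := m₁.of_equiv e₃
    rwa [← show N₂ᵀ 0 0 = N₁ 0 0 from v₂] at this
  refine ⟨N₂ᵀ, (e₀.trans e₁).trans e₃, fun i hi => r₂ (fun i hi => c₁ i hi) i hi,
    fun j hj => c₂ j hj, fun i j => ?_⟩
  by_cases hi : i = 0
  · rw [hi]; exact m₂.dvd_row j
  by_cases hj : j = 0
  · rw [hj]; exact m₂.dvd_col i
  have e₄ := MatEquiv.addRows N₂ᵀ i (Pi.single 0 1) (by simp [hi])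
  set N₃ : Matrix (Fin (n + 1)) (Fin (n + 1)) F[X] :=
    Matrix.of fun a b => N₂ᵀ a b + (Pi.single 0 1 : Fin (n + 1) → F[X]) a * N₂ᵀ i b with hN₃
  have hi0 : N₂ᵀ i 0 = 0 := r₂ (fun i hi => c₁ i hi) i hi
  have h0j : N₂ᵀ 0 j = 0 := c₂ j hj
  have v₃ : N₃ 0 0 = N₂ᵀ 0 0 := by
    rw [hN₃, of_apply, hi0]; simp
  have w₃ : N₃ 0 j = N₂ᵀ i j := by
    rw [hN₃, of_apply, h0j]; simp
  have m₃ : IsMinEntry N₃ (N₃ 0 0) := v₃ ▸ m₂.of_equiv e₄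
  have := m₃.dvd_row j
  rwa [v₃, w₃] at this

/-- Smith normal form of a square polynomial matrix, with divisibility chain. -/
theorem exists_smith (n : ℕ) (M : Matrix (Fin n) (Fin n) F[X]) :
    ∃ f : ℕ → F[X], MatEquiv M (diagonal fun i : Fin n => f i) ∧
      ∀ i, i + 1 < n → f i ∣ f (i + 1) := by
  induction n with
  | zero => exact ⟨0, ⟨1, 1, by simp, by simp, Subsingleton.elim _ _⟩, by simp⟩
  | succ n ih =>
    obtain ⟨N, hN, hc, hr, hd⟩ := exists_smith_step M
    obtain ⟨f, ⟨U, V, hU, hV, hUV⟩, hf⟩ := ih (N.submatrix Fin.succ Fin.succ)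
    let b : Matrix (Fin n) (Fin n) F[X] → Matrix (Fin (n + 1)) (Fin (n + 1)) F[X] := fun W =>
      Matrix.of (Fin.cons (Pi.single 0 1) fun i => Fin.cons 0 (W i))
    have hb : ∀ W, (b W).det = W.det := fun W => by
      rw [det_succ_row_zero, Fin.sum_univ_succ]
      have : (b W).submatrix Fin.succ Fin.succ = W := by
        ext i j; simp [b]
      simp [b, this]
    refine ⟨fun i => Nat.casesOn i (N 0 0) f, hN.trans ⟨b U, b V, by rwa [hb], by rwa [hb], ?_⟩, ?_⟩
    · have hUV' : ∀ i j, ∑ x, (∑ y, U i y * N y.succ x.succ) * V x j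
          = if i = j then f i else 0 := by
        intro i j
        have := congrFun (congrFun hUV i) j
        simpa [mul_apply, diagonal_apply] using this
      ext i j
      refine Fin.cases ?_ (fun i => ?_) i <;> refine Fin.cases ?_ (fun j => ?_) j
      · simp [b, mul_apply, Fin.sum_univ_succ]
      · simp [b, mul_apply, Fin.sum_univ_succ, hr, diagonal_apply_ne _ (Fin.succ_ne_zero j).symm]
      · simp [b, mul_apply, Fin.sum_univ_succ, hc]
      · simp [b, mul_apply, Fin.sum_univ_succ, diagonal_apply, hUV']
    · rintro (_ | i) hi
      · have h0 : f 0 = (U * N.submatrix Fin.succ Fin.succ * V) ⟨0, by omega⟩ ⟨0, by omega⟩ := by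
          rw [hUV]; simp
        change N 0 0 ∣ f 0
        rw [h0, mul_apply]
        refine Finset.dvd_sum fun x _ => Dvd.dvd.mul_right ?_ _
        rw [mul_apply]
        exact Finset.dvd_sum fun y _ => Dvd.dvd.mul_left (hd _ _) _
      · exact hf i (by omega)

end SmithField

section Minors

variable {R : Type*} [CommRing R] {n : ℕ}

theorem dvd_minors_mul {m l k : ℕ} (M : Matrix (Fin m) (Fin n) R) (V : Matrix (Fin n) (Fin l) R)
    {d : R} (hd : ∀ x ∈ minorsSet M k, d ∣ x) : ∀ x ∈ minorsSet (M * V) k, d ∣ x := by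
  classical
  rintro _ ⟨ri, ci, hri, -, rfl⟩
  have h1 : ((M * V).submatrix ri ci).det = detRowAlternating
      (fun j => ∑ l : Fin n, V l (ci j) • fun i => M (ri i) l) := by
    rw [← det_transpose]
    change detRowAlternating _ = _
    congr 1
    ext j i
    simp [mul_apply, mul_comm]
  rw [h1, ← AlternatingMap.coe_multilinearMap, MultilinearMap.map_sum]
  refine Finset.dvd_sum fun c _ => ?_
  rw [MultilinearMap.map_smul_univ, smul_eq_mul]
  refine Dvd.dvd.mul_left ?_ _
  rw [AlternatingMap.coe_multilinearMap]
  by_cases hc : Function.Injective c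
  · refine hd _ ⟨ri, c, hri, hc, ?_⟩
    rw [← det_transpose]
    rfl
  · rw [AlternatingMap.map_eq_zero_of_not_injective]
    · exact dvd_zero _
    · exact fun h => hc fun a b hab => h (by simp [hab])

theorem minorsSet_transpose {m : ℕ} (M : Matrix (Fin m) (Fin n) R) (k : ℕ) :
    minorsSet Mᵀ k = minorsSet M k := by
  ext x
  constructor <;> rintro ⟨ri, ci, hri, hci, rfl⟩ <;> refine ⟨ci, ri, hci, hri, ?_⟩
  · rw [← det_transpose]; rfl
  · rw [← det_transpose]; rfl

theorem MatEquiv.dvd_minors {M N : Matrix (Fin n) (Fin n) R} (h : MatEquiv M N) {k : ℕ} {d : R}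
    (hd : ∀ x ∈ minorsSet M k, d ∣ x) : ∀ x ∈ minorsSet N k, d ∣ x := by
  obtain ⟨U, V, -, -, rfl⟩ := h
  refine dvd_minors_mul _ _ ?_
  rw [← minorsSet_transpose, transpose_mul]
  refine dvd_minors_mul _ _ ?_
  rwa [minorsSet_transpose]

theorem MatEquiv.symm {M N : Matrix (Fin n) (Fin n) R} (h : MatEquiv M N) : MatEquiv N M := by
  obtain ⟨U, V, hU, hV, rfl⟩ := h
  refine ⟨U⁻¹, V⁻¹, isUnit_nonsing_inv_det _ hU, isUnit_nonsing_inv_det _ hV, ?_⟩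
  rw [Matrix.mul_assoc U, nonsing_inv_mul_cancel_left _ _ hU,
    mul_nonsing_inv_cancel_right _ _ hV]

theorem dvd_of_chain {f : ℕ → R} (hf : ∀ i, i + 1 < n → f i ∣ f (i + 1)) {i j : ℕ} (hij : i ≤ j)
    (hj : j < n) : f i ∣ f j := by
  induction j, hij using Nat.le_induction with
  | base => exact dvd_rfl
  | succ j _ ih => exact (ih (by omega)).trans (hf j hj)

theorem prod_range_dvd_of_chain {f : ℕ → R} (hf : ∀ i, i + 1 < n → f i ∣ f (i + 1)) {k : ℕ}
    (s : Finset ℕ) (hs : s ⊆ Finset.range n) (hk : s.card = k) :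
    ∏ i ∈ Finset.range k, f i ∣ ∏ i ∈ s, f i := by
  induction k generalizing s with
  | zero => simp
  | succ k ih =>
    have hne : s.Nonempty := Finset.card_pos.1 (by omega)
    have hmem := s.max'_mem hne
    rw [Finset.prod_range_succ, ← Finset.prod_erase_mul s f hmem]
    refine mul_dvd_mul (ih _ ((Finset.erase_subset _ _).trans hs) (by
      rw [Finset.card_erase_of_mem hmem, hk]; rfl)) (dvd_of_chain hf ?_
        (Finset.mem_range.1 (hs hmem)))
    have : s ⊆ Finset.range (s.max' hne + 1) := fun x hx =>
      Finset.mem_range.2 (Nat.lt_succ_of_le (s.le_max' x hx))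
    have := Finset.card_le_card this
    simp at this
    omega

theorem isGCDOf_diagonal {f : ℕ → R} (hf : ∀ i, i + 1 < n → f i ∣ f (i + 1)) {k : ℕ}
    (hk : k ≤ n) : IsGCDOf (∏ i ∈ Finset.range k, f i)
      (minorsSet (diagonal fun i : Fin n => f i) k) := by
  classical
  constructor
  · rintro _ ⟨ri, ci, hri, hci, rfl⟩
    rw [det_apply]
    refine Finset.dvd_sum fun σ _ => ?_
    rw [Units.smul_def, zsmul_eq_mul]
    refine Dvd.dvd.mul_left ?_ _
    by_cases h : ∀ j, ri (σ j) = ci j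
    · have : ∏ i, ((diagonal fun i : Fin n => f i).submatrix ri ci) (σ i) i
          = ∏ i ∈ Finset.univ.image (fun j => (ci j : ℕ)), f i := by
        rw [Finset.prod_image (fun a _ b _ hab => hci (Fin.ext hab))]
        refine Finset.prod_congr rfl fun j _ => ?_
        simp [h j]
      rw [this]
      refine prod_range_dvd_of_chain hf _ ?_ ?_
      · intro x hx
        obtain ⟨j, -, rfl⟩ := Finset.mem_image.1 hx
        simp
      · rw [Finset.card_image_of_injective _ (fun a b hab => hci (Fin.ext hab))]
        simp
    · push Not at h
      obtain ⟨j, hj⟩ := h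
      rw [Finset.prod_eq_zero (Finset.mem_univ j)]
      · exact dvd_zero _
      · simp [hj]
  · intro d hd
    refine hd _ ⟨Fin.castLE hk, Fin.castLE hk, Fin.castLE_injective hk, Fin.castLE_injective hk, ?_⟩
    rw [submatrix_diagonal _ _ (Fin.castLE_injective hk), det_diagonal, ← Fin.prod_univ_eq_prod_range]
    rfl

theorem MatEquiv.isGCDOf {M : Matrix (Fin n) (Fin n) R} {f : ℕ → R}
    (h : MatEquiv M (diagonal fun i : Fin n => f i)) (hf : ∀ i, i + 1 < n → f i ∣ f (i + 1))
    {k : ℕ} (hk : k ≤ n) : IsGCDOf (∏ i ∈ Finset.range k, f i) (minorsSet M k) :=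
  ⟨h.symm.dvd_minors (isGCDOf_diagonal hf hk).1,
    fun d hd => (isGCDOf_diagonal hf hk).2 d (h.dvd_minors hd)⟩

end Minors

section Homogeneous

/-- The ring homomorphism substituting `z • x` for `x`; the coefficients of the result are the
homogeneous components. -/
noncomputable def scaleHom (σ R : Type*) [CommRing R] :
    MvPolynomial σ R →+* (MvPolynomial σ R)[X] :=
  MvPolynomial.eval₂Hom (Polynomial.C.comp MvPolynomial.C)
    fun i => Polynomial.C (MvPolynomial.X i) * Polynomial.X

variable {σ R : Type*} [CommRing R]

theorem scaleHom_monomial (d : σ →₀ ℕ) (a : R) :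
    scaleHom σ R (MvPolynomial.monomial d a)
      = Polynomial.monomial d.degree (MvPolynomial.monomial d a) := by
  rw [scaleHom, MvPolynomial.coe_eval₂Hom, MvPolynomial.eval₂_monomial,
    ← Polynomial.C_mul_X_pow_eq_monomial, MvPolynomial.monomial_eq]
  simp only [mul_pow, Finsupp.prod, Finset.prod_mul_distrib, RingHom.comp_apply, map_mul,
    map_prod, map_pow, Finset.prod_pow_eq_pow_sum, mul_assoc]
  rfl

theorem degree_eq_of_isHomogeneous {p : MvPolynomial σ R} {m : ℕ} (hp : p.IsHomogeneous m)
    {d : σ →₀ ℕ} (hd : p.coeff d ≠ 0) : d.degree = m := by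
  rw [Finsupp.degree_eq_weight_one]
  exact hp hd

theorem scaleHom_of_isHomogeneous {p : MvPolynomial σ R} {m : ℕ} (hp : p.IsHomogeneous m) :
    scaleHom σ R p = Polynomial.monomial m p := by
  conv_lhs => rw [p.as_sum]
  conv_rhs => rw [p.as_sum]
  rw [map_sum, map_sum]
  refine Finset.sum_congr rfl fun d hd => ?_
  rw [scaleHom_monomial, degree_eq_of_isHomogeneous hp]
  exact MvPolynomial.mem_support_iff.1 hd

theorem eval_one_scaleHom (p : MvPolynomial σ R) : (scaleHom σ R p).eval 1 = p := by
  have : (Polynomial.evalRingHom 1).comp (scaleHom σ R) = RingHom.id _ := by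
    refine MvPolynomial.ringHom_ext ?_ ?_ <;> intro <;> simp [scaleHom]
  exact congrArg (fun g : MvPolynomial σ R →+* MvPolynomial σ R => g p) this

theorem isHomogeneous_of_scaleHom {p : MvPolynomial σ R} {m : ℕ}
    (hp : scaleHom σ R p = Polynomial.monomial m p) : p.IsHomogeneous m := by
  classical
  intro d hd
  by_contra hne
  have h1 : scaleHom σ R p
      = ∑ d ∈ p.support, Polynomial.monomial d.degree (MvPolynomial.monomial d (p.coeff d)) := by
    conv_lhs => rw [p.as_sum]
    rw [map_sum]
    exact Finset.sum_congr rfl fun d _ => scaleHom_monomial _ _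
  have h2 := congrArg (fun q => (q.coeff d.degree).coeff d) (h1.symm.trans hp)
  have hne' : m ≠ d.degree := fun h => hne (by
    rw [h, Finsupp.degree_eq_weight_one]; rfl)
  simp only [Polynomial.coeff_monomial, Polynomial.finsetSum_coeff, if_neg hne',
    MvPolynomial.coeff_sum, MvPolynomial.coeff_zero] at h2
  rw [Finset.sum_eq_single d] at h2
  · simp at h2
    exact hd h2
  · intro b _ hb
    split_ifs
    · rw [MvPolynomial.coeff_monomial, if_neg hb]
    · simp
  · intro hd'
    simpa using hd'

theorem exists_isHomogeneous_of_dvd [IsDomain R] {p q : MvPolynomial σ R} {n : ℕ}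
    (hq : q.IsHomogeneous n) (hq0 : q ≠ 0) (h : p ∣ q) : ∃ m, p.IsHomogeneous m := by
  obtain ⟨e, rfl⟩ := h
  have hz : scaleHom σ R p ∣ Polynomial.monomial n (p * e) := by
    rw [← scaleHom_of_isHomogeneous hq, map_mul]
    exact dvd_mul_right _ _
  have hz0 : Polynomial.monomial n (p * e) ≠ 0 := by simpa using hq0
  obtain ⟨w, hw⟩ := hz
  have hp0 : scaleHom σ R p ≠ 0 := fun h0 => hz0 (by rw [hw, h0, zero_mul])
  have hw0 : w ≠ 0 := fun h0 => hz0 (by rw [hw, h0, mul_zero])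
  have hd := Polynomial.natDegree_mul hp0 hw0
  have ht := Polynomial.natTrailingDegree_mul hp0 hw0
  rw [← hw, Polynomial.natDegree_monomial_eq n hq0] at hd
  rw [← hw, Polynomial.natTrailingDegree_monomial hq0] at ht
  have h1 := Polynomial.natTrailingDegree_le_natDegree (scaleHom σ R p)
  have h2 := Polynomial.natTrailingDegree_le_natDegree w
  have h3 : (scaleHom σ R p).natTrailingDegree = (scaleHom σ R p).natDegree := by omega
  refine ⟨(scaleHom σ R p).natDegree, isHomogeneous_of_scaleHom ?_⟩
  have h4 : scaleHom σ R p = Polynomial.monomial (scaleHom σ R p).natDegree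
      ((scaleHom σ R p).coeff (scaleHom σ R p).natDegree) := by
    ext1 k
    rw [Polynomial.coeff_monomial]
    split_ifs with hk
    · rw [hk]
    · rcases lt_or_gt_of_ne hk with hk | hk
      · exact Polynomial.coeff_eq_zero_of_natDegree_lt hk
      · exact Polynomial.coeff_eq_zero_of_lt_natTrailingDegree (h3 ▸ hk)
  have h5 := eval_one_scaleHom p
  rw [h4] at h5
  simp only [Polynomial.eval_monomial, one_pow, mul_one] at h5
  rw [h5] at h4
  exact h4

end Homogeneous

section Dehomogenize

variable {F : Type*} [Field F] {n : ℕ}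

/-- The substitution `s = X`, `t = 1`. -/
noncomputable def dehom (F : Type*) [Field F] : MvPolynomial (Fin 2) F →+* F[X] :=
  (MvPolynomial.aeval ![Polynomial.X, 1] : MvPolynomial (Fin 2) F →ₐ[F] F[X])

/-- The homogenization of a polynomial in its own degree. -/
noncomputable def hom (f : F[X]) : MvPolynomial (Fin 2) F := f.homogenize f.natDegree

theorem hom_mul (f g : F[X]) : hom (f * g) = hom f * hom g := by
  by_cases hf : f = 0
  · simp [hf, hom]
  by_cases hg : g = 0
  · simp [hg, hom]
  rw [hom, natDegree_mul hf hg, homogenize_mul _ _ le_rfl le_rfl]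
  rfl

theorem dehom_hom (f : F[X]) : dehom F (hom f) = f :=
  aeval_homogenize_X_one f le_rfl

theorem hom_dvd_hom {f g : F[X]} : hom f ∣ hom g ↔ f ∣ g := by
  refine ⟨fun h => ?_, homogenize_dvd⟩
  have := map_dvd (dehom F) h
  rwa [dehom_hom, dehom_hom] at this

theorem natDegree_dehom_le {p : MvPolynomial (Fin 2) F} {k : ℕ} (hp : p.IsHomogeneous k) :
    (dehom F p).natDegree ≤ k := by
  rw [p.as_sum, map_sum]
  refine natDegree_sum_le_of_forall_le _ _ fun d hd => ?_
  have h1 := degree_eq_of_isHomogeneous hp (MvPolynomial.mem_support_iff.1 hd)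
  have : dehom F (MvPolynomial.monomial d (p.coeff d))
      = Polynomial.C (p.coeff d) * Polynomial.X ^ d 0 := by
    rw [dehom, RingHom.coe_coe, MvPolynomial.aeval_monomial, Finsupp.prod_fintype _ _ (by simp)]
    simp
  rw [this]
  refine (natDegree_C_mul_X_pow_le _ _).trans ?_
  rw [← h1]
  exact Finsupp.le_degree 0 d

theorem hom_dvd_of_dvd_dehom {p : MvPolynomial (Fin 2) F} {k : ℕ} (hp : p.IsHomogeneous k)
    {d : F[X]} (hd : d ∣ dehom F p) : hom d ∣ p := by
  have h1 : (dehom F p).homogenize k = p := homogenize_eq_of_isHomogeneous hp rfl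
  have h2 := natDegree_dehom_le hp
  obtain ⟨e, he⟩ := hd
  rw [← h1]
  by_cases h0 : dehom F p = 0
  · simp [h0]
  have hd0 : d ≠ 0 := fun h => h0 (by rw [he, h, zero_mul])
  have he0 : e ≠ 0 := fun h => h0 (by rw [he, h, mul_zero])
  rw [he, natDegree_mul hd0 he0] at h2
  refine ⟨homogenize e (k - d.natDegree), ?_⟩
  rw [hom, ← homogenize_mul _ _ le_rfl (by omega), ← he]
  congr 1
  omega

theorem map_homPencil_dehom (G₀ G₁ : Matrix (Fin n) (Fin n) F) :
    (homPencil G₀ G₁).map (dehom F) = pencilOf G₀ G₁ := by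
  ext1 i j
  simp [homPencil, pencilOf, dehom]

theorem det_isHomogeneous {ι : Type*} [Fintype ι] [DecidableEq ι]
    {M : Matrix ι ι (MvPolynomial (Fin 2) F)} (hM : ∀ i j, (M i j).IsHomogeneous 1) :
    M.det.IsHomogeneous (Fintype.card ι) := by
  rw [det_apply]
  refine MvPolynomial.IsHomogeneous.sum _ _ _ fun σ _ => ?_
  have : (∏ i, M (σ i) i).IsHomogeneous (∑ _i : ι, 1) :=
    MvPolynomial.IsHomogeneous.prod _ _ _ fun i _ => hM _ _
  simp only [Finset.sum_const, smul_eq_mul, mul_one, Finset.card_univ] at this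
  rcases Int.units_eq_one_or (Equiv.Perm.sign σ) with h | h <;> rw [h]
  · simpa using this
  · simpa using this.neg

theorem homPencil_isHomogeneous (G₀ G₁ : Matrix (Fin n) (Fin n) F) (i j : Fin n) :
    (homPencil G₀ G₁ i j).IsHomogeneous 1 := by
  have h (a : Fin 2) (c : F) : (MvPolynomial.X a * MvPolynomial.C c :
      MvPolynomial (Fin 2) F).IsHomogeneous 1 := by
    simpa using (MvPolynomial.isHomogeneous_X F a).mul (MvPolynomial.isHomogeneous_C (Fin 2) c)
  simpa [homPencil] using (h 1 (G₀ i j)).add (h 0 (G₁ i j))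

theorem minorsSet_isHomogeneous (G₀ G₁ : Matrix (Fin n) (Fin n) F) {k : ℕ}
    {x : MvPolynomial (Fin 2) F} (hx : x ∈ minorsSet (homPencil G₀ G₁) k) :
    x.IsHomogeneous k := by
  obtain ⟨ri, ci, -, -, rfl⟩ := hx
  simpa using det_isHomogeneous (M := (homPencil G₀ G₁).submatrix ri ci)
    fun i j => homPencil_isHomogeneous _ _ _ _

theorem minorsSet_map {R S : Type*} [CommRing R] [CommRing S] (g : R →+* S) {m l : ℕ}
    (M : Matrix (Fin m) (Fin l) R) (k : ℕ) : minorsSet (M.map g) k = g '' minorsSet M k := by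
  ext x
  constructor
  · rintro ⟨ri, ci, hri, hci, rfl⟩
    exact ⟨_, ⟨ri, ci, hri, hci, rfl⟩, by rw [RingHom.map_det]; rfl⟩
  · rintro ⟨_, ⟨ri, ci, hri, hci, rfl⟩, rfl⟩
    exact ⟨ri, ci, hri, hci, by rw [RingHom.map_det]; rfl⟩

theorem det_mem_minorsSet {R : Type*} [CommRing R] (M : Matrix (Fin n) (Fin n) R) :
    M.det ∈ minorsSet M n :=
  ⟨id, id, Function.injective_id, Function.injective_id, by simp⟩

/-- The substitution `s = 1`, `t = 0`. -/
noncomputable def atInfty (F : Type*) [Field F] : MvPolynomial (Fin 2) F →+* F :=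
  MvPolynomial.eval ![1, 0]

theorem map_homPencil_atInfty (G₀ G₁ : Matrix (Fin n) (Fin n) F) :
    (homPencil G₀ G₁).map (atInfty F) = G₁ := by
  ext1 i j
  simp [homPencil, atInfty]

theorem isUnit_of_dvd_det_homPencil {G₀ G₁ : Matrix (Fin n) (Fin n) F} (h₁ : IsUnit G₁.det)
    {e : MvPolynomial (Fin 2) F} (he : e ∣ (homPencil G₀ G₁).det) (hu : IsUnit (dehom F e)) :
    IsUnit e := by
  have hinf : atInfty F (homPencil G₀ G₁).det = G₁.det := by
    rw [RingHom.map_det, RingHom.mapMatrix_apply, map_homPencil_atInfty]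
  have h0 : (homPencil G₀ G₁).det ≠ 0 := fun h => h₁.ne_zero (by rw [← hinf, h, map_zero])
  obtain ⟨m, hm⟩ := exists_isHomogeneous_of_dvd
    (minorsSet_isHomogeneous G₀ G₁ (det_mem_minorsSet _)) h0 he
  obtain ⟨c, hc, hce⟩ := Polynomial.isUnit_iff.1 hu
  have h1 : (dehom F e).homogenize m = e := homogenize_eq_of_isHomogeneous hm rfl
  rw [← hce, homogenize_C] at h1
  have h2 : atInfty F e ≠ 0 := fun h => by
    have := map_dvd (atInfty F) he
    rw [hinf, h, zero_dvd_iff] at this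
    exact h₁.ne_zero this
  rw [← h1] at h2 ⊢
  rcases Nat.eq_zero_or_pos m with rfl | hm0
  · simpa using hc.map (MvPolynomial.C (σ := Fin 2))
  · simp [atInfty, hm0.ne'] at h2

theorem isUnit_dehom {g : F[X]} (hg : g ≠ 0) {e : MvPolynomial (Fin 2) F}
    (h : dehom F (hom g * e) ∣ g) : IsUnit (dehom F e) := by
  rw [RingHom.map_mul, dehom_hom] at h
  exact isUnit_of_dvd_one ((mul_dvd_mul_iff_left hg).1 (by rwa [mul_one]))

theorem associated_hom {G₀ G₁ : Matrix (Fin n) (Fin n) F} (h₁ : IsUnit G₁.det)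
    {φ : ℕ → MvPolynomial (Fin 2) F} (hφ : IsHomogeneousIF G₀ G₁ φ) {f : ℕ → F[X]}
    (hf : ∀ k ≤ n, IsGCDOf (∏ i ∈ Finset.range k, f i) (minorsSet (pencilOf G₀ G₁) k))
    (hf0 : ∀ i < n, f i ≠ 0) {i : ℕ} (hi : i < n) : Associated (φ i) (hom (f i)) := by
  have key : ∀ k ≤ n, Associated (∏ i ∈ Finset.range k, φ i)
      (hom (∏ i ∈ Finset.range k, f i)) := by
    intro k hk
    have hd : hom (∏ i ∈ Finset.range k, f i) ∣ ∏ i ∈ Finset.range k, φ i := by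
      refine (hφ k hk).2 _ fun x hx =>
        hom_dvd_of_dvd_dehom (minorsSet_isHomogeneous _ _ hx) ((hf k hk).1 _ ?_)
      rw [← map_homPencil_dehom, minorsSet_map]
      exact ⟨x, hx, rfl⟩
    have hd' : dehom F (∏ i ∈ Finset.range k, φ i) ∣ ∏ i ∈ Finset.range k, f i := by
      refine (hf k hk).2 _ ?_
      rw [← map_homPencil_dehom, minorsSet_map]
      rintro _ ⟨x, hx, rfl⟩
      exact map_dvd (dehom F) ((hφ k hk).1 x hx)
    obtain ⟨e, he⟩ := hd
    have hne : ∏ i ∈ Finset.range k, f i ≠ 0 :=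
      Finset.prod_ne_zero_iff.2 fun i hi => hf0 i ((Finset.mem_range.1 hi).trans_le hk)
    have hu : IsUnit (dehom F e) := isUnit_dehom hne (he ▸ hd')
    have he' : e ∣ (homPencil G₀ G₁).det := by
      refine (Dvd.intro_left _ he.symm).trans ((Finset.prod_dvd_prod_of_subset _ _ _
        (Finset.range_subset_range.2 hk)).trans ((hφ n le_rfl).1 _ (det_mem_minorsSet _)))
    rw [he]
    exact associated_mul_unit_left _ _ (isUnit_of_dvd_det_homPencil h₁ he' hu)
  have h1 := key (i + 1) hi
  rw [Finset.prod_range_succ, Finset.prod_range_succ, hom_mul] at h1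
  refine h1.of_mul_left (key i hi.le) ?_
  intro h
  have h2 := (key i hi.le).dvd
  rw [h, zero_dvd_iff] at h2
  have := dehom_hom (∏ i ∈ Finset.range i, f i)
  rw [h2, map_zero] at this
  exact Finset.prod_ne_zero_iff.2 (fun j hj => hf0 j ((Finset.mem_range.1 hj).trans hi)) this.symm

end Dehomogenize

section Interlacing

variable {R : Type*} [CommRing R] {n r : ℕ}

/-- The interlacing condition in terms of indices starting at `0`. -/
def ShiftDvd (n r : ℕ) (f g : ℕ → R) : Prop :=
  ∀ i, i + r < n → f i ∣ g (i + r) ∧ g i ∣ f (i + r)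

theorem extIF_of_pos {φ : ℕ → R} {i : ℕ} (hi : i < n) : extIF n φ ((i : ℤ) + 1) = φ i := by
  have h1 : ¬ ((i : ℤ) + 1 < 1) := by omega
  have h2 : ¬ ((n : ℤ) < (i : ℤ) + 1) := by omega
  simp [extIF, h2]

theorem interlace_iff_shiftDvd {φ ψ : ℕ → R} : Interlace n r φ ψ ↔ ShiftDvd n r φ ψ := by
  constructor
  · intro h i hi
    have h1 := (h (i + r + 1) (by omega) (by omega)).1
    have h2 := (h (i + 1) (by omega) (by omega)).2
    have e1 : ((i + r + 1 : ℕ) : ℤ) - r = (i : ℤ) + 1 := by push_cast; ring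
    have e2 : ((i + r + 1 : ℕ) : ℤ) = ((i + r : ℕ) : ℤ) + 1 := by push_cast; ring
    have e3 : ((i + 1 : ℕ) : ℤ) + r = ((i + r : ℕ) : ℤ) + 1 := by push_cast; ring
    have e4 : ((i + 1 : ℕ) : ℤ) = (i : ℤ) + 1 := by push_cast; ring
    rw [e1, e2, extIF_of_pos (by omega), extIF_of_pos (by omega)] at h1
    rw [e3, e4, extIF_of_pos (by omega), extIF_of_pos (by omega)] at h2
    exact ⟨h1, h2⟩
  · intro h i hi hin
    obtain ⟨i, rfl⟩ : ∃ j, i = j + 1 := ⟨i - 1, by omega⟩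
    have e4 : ((i + 1 : ℕ) : ℤ) = (i : ℤ) + 1 := by push_cast; ring
    rw [e4]
    constructor
    · by_cases hr : i < r
      · have : (i : ℤ) + 1 - r < 1 := by omega
        simp [extIF, this]
      · obtain ⟨j, rfl⟩ : ∃ j, i = j + r := ⟨i - r, by omega⟩
        have e1 : ((j + r : ℕ) : ℤ) + 1 - r = (j : ℤ) + 1 := by push_cast; ring
        rw [e1, extIF_of_pos (by omega), extIF_of_pos (by omega)]
        exact (h j (by omega)).1
    · by_cases hr : n ≤ i + r
      · have h1 : ¬ ((i : ℤ) + 1 + r < 1) := by omega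
        have h2 : (n : ℤ) < (i : ℤ) + 1 + r := by omega
        have : extIF n φ ((i : ℤ) + 1 + r) = 0 := by
          rw [extIF, if_neg h1, if_pos h2]
        rw [this]
        exact dvd_zero _
      · have e1 : (i : ℤ) + 1 + r = ((i + r : ℕ) : ℤ) + 1 := by push_cast; ring
        rw [e1, extIF_of_pos (by omega), extIF_of_pos (by omega)]
        exact (h i (by omega)).2

theorem ShiftDvd.mono {f g : ℕ → R} (hf : ∀ i, i + 1 < n → f i ∣ f (i + 1))
    (hg : ∀ i, i + 1 < n → g i ∣ g (i + 1)) (h : ShiftDvd n r f g) {s : ℕ} (hs : r ≤ s) :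
    ShiftDvd n s f g := fun i hi =>
  ⟨(h i (by omega)).1.trans (dvd_of_chain hg (by omega) hi),
    (h i (by omega)).2.trans (dvd_of_chain hf (by omega) hi)⟩

theorem shiftDvd_congr {S : Type*} [CommRing S] {f g : ℕ → R} {f' g' : ℕ → S}
    (hfg : ∀ i < n, ∀ j < n, f i ∣ g j ↔ f' i ∣ g' j)
    (hgf : ∀ i < n, ∀ j < n, g i ∣ f j ↔ g' i ∣ f' j) :
    ShiftDvd n r f g ↔ ShiftDvd n r f' g' := by
  refine forall_congr' fun i => forall_congr' fun hi => ?_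
  rw [hfg i (by omega) _ hi, hgf i (by omega) _ hi]

theorem sInf_shiftDvd_le_iff {f g : ℕ → R} (hf : ∀ i, i + 1 < n → f i ∣ f (i + 1))
    (hg : ∀ i, i + 1 < n → g i ∣ g (i + 1)) :
    sInf {r' : ℕ | ShiftDvd n r' f g} ≤ r ↔ ShiftDvd n r f g := by
  refine ⟨fun h => ?_, fun h => Nat.sInf_le h⟩
  have hne : {r' : ℕ | ShiftDvd n r' f g}.Nonempty := ⟨n, fun i hi => by omega⟩
  exact ShiftDvd.mono hf hg (Nat.sInf_mem hne) h

end Interlacing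

section InvariantFactors

variable {F : Type*} [Field F] {n : ℕ}

theorem coeff_det_pencilOf (G₀ G₁ : Matrix (Fin n) (Fin n) F) :
    (pencilOf G₀ G₁).det.coeff n = G₁.det := by
  have := Polynomial.coeff_det_X_add_C_card G₁ G₀
  rwa [Fintype.card_fin, add_comm] at this

theorem natDegree_det_pencilOf {G₀ G₁ : Matrix (Fin n) (Fin n) F} (h : IsUnit G₁.det) :
    (pencilOf G₀ G₁).det.natDegree = n := by
  refine natDegree_eq_of_le_of_coeff_ne_zero ?_ (coeff_det_pencilOf G₀ G₁ ▸ h.ne_zero)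
  have := Polynomial.natDegree_det_X_add_C_le G₁ G₀
  rwa [Fintype.card_fin, add_comm] at this

theorem det_pencilOf_ne_zero {G₀ G₁ : Matrix (Fin n) (Fin n) F} (h : IsUnit G₁.det) :
    (pencilOf G₀ G₁).det ≠ 0 := fun h0 => h.ne_zero (by
  rw [← coeff_det_pencilOf G₀ G₁, h0, coeff_zero])

/-- `f 0, …, f (n - 1)` is a chain of nonzero polynomials with degrees adding up to `n`. -/
structure IsFactorChain (n : ℕ) (f : ℕ → F[X]) : Prop where
  chain : ∀ i, i + 1 < n → f i ∣ f (i + 1)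
  ne_zero : ∀ i < n, f i ≠ 0
  sum_natDegree : ∑ i ∈ Finset.range n, (f i).natDegree = n

/-- `f 0 ∣ ⋯ ∣ f (n - 1)` are the invariant factors of `M`, all nonzero, with degrees adding
up to `n`. -/
structure IsSmithForm (M : Matrix (Fin n) (Fin n) F[X]) (f : ℕ → F[X]) : Prop
    extends IsFactorChain n f where
  equiv : MatEquiv M (diagonal fun i : Fin n => f i)

theorem exists_isSmithForm {G₀ G₁ : Matrix (Fin n) (Fin n) F} (h : IsUnit G₁.det) :
    ∃ f, IsSmithForm (pencilOf G₀ G₁) f := by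
  obtain ⟨f, hf, hc⟩ := exists_smith n (pencilOf G₀ G₁)
  have h0 := det_pencilOf_ne_zero (G₀ := G₀) h
  have hdet : Associated (pencilOf G₀ G₁).det (∏ i ∈ Finset.range n, f i) := by
    obtain ⟨U, V, hU, hV, hUV⟩ := hf
    have := congrArg det hUV
    rw [det_mul, det_mul, det_diagonal, Fin.prod_univ_eq_prod_range] at this
    rw [← this]
    exact ((associated_mul_unit_left _ _ hV).trans (associated_unit_mul_left _ _ hU)).symm
  have hp : ∏ i ∈ Finset.range n, f i ≠ 0 := hdet.ne_zero_iff.1 h0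
  have hne : ∀ i < n, f i ≠ 0 := fun i hi =>
    Finset.prod_ne_zero_iff.1 hp i (Finset.mem_range.2 hi)
  refine ⟨f, ⟨hc, hne, ?_⟩, hf⟩
  rw [← natDegree_prod _ _ fun i hi => hne i (Finset.mem_range.1 hi),
    ← natDegree_eq_of_degree_eq (degree_eq_degree_of_associated hdet), natDegree_det_pencilOf h]

theorem interlace_iff_of_isSmithForm {r : ℕ} {A₀ A₁ B₀ B₁ : Matrix (Fin n) (Fin n) F}
    (hA : IsUnit A₁.det) (hB : IsUnit B₁.det) {φ ψ : ℕ → MvPolynomial (Fin 2) F}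
    (hφ : IsHomogeneousIF A₀ A₁ φ) (hψ : IsHomogeneousIF B₀ B₁ ψ) {f g : ℕ → F[X]}
    (hf : IsSmithForm (pencilOf A₀ A₁) f) (hg : IsSmithForm (pencilOf B₀ B₁) g) :
    Interlace n r φ ψ ↔ ShiftDvd n r f g := by
  rw [interlace_iff_shiftDvd]
  have h1 : ∀ i < n, Associated (φ i) (hom (f i)) := fun i hi =>
    associated_hom hA hφ (fun k hk => hf.equiv.isGCDOf hf.chain hk) hf.ne_zero hi
  have h2 : ∀ i < n, Associated (ψ i) (hom (g i)) := fun i hi =>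
    associated_hom hB hψ (fun k hk => hg.equiv.isGCDOf hg.chain hk) hg.ne_zero hi
  refine shiftDvd_congr (fun i hi j hj => ?_) fun i hi j hj => ?_
  · rw [(h1 i hi).dvd_iff_dvd_left, (h2 j hj).dvd_iff_dvd_right, hom_dvd_hom]
  · rw [(h2 i hi).dvd_iff_dvd_left, (h1 j hj).dvd_iff_dvd_right, hom_dvd_hom]

end InvariantFactors

section Rank

variable {K : Type*} [Field K] {n : ℕ}

theorem rank_add_le' {m : ℕ} (M N : Matrix (Fin m) (Fin n) K) :
    (M + N).rank ≤ M.rank + N.rank := by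
  rw [rank, rank, rank, mulVecLin_add]
  exact (Submodule.finrank_mono (LinearMap.range_add_le _ _)).trans
    (Submodule.finrank_add_le_finrank_add_finrank _ _)

theorem rank_neg' {m : ℕ} (M : Matrix (Fin m) (Fin n) K) : (-M).rank = M.rank := by
  have : -M = (-1 : K) • M := by simp
  rw [this, rank_smul_of_mem_nonZeroDivisors _ (mem_nonZeroDivisors_of_ne_zero (by simp))]

theorem rank_map_ringHom {L : Type*} [Field L] (g : K →+* L) (M : Matrix (Fin n) (Fin n) K) :
    (M.map g).rank = M.rank := by
  classical
  obtain ⟨L₁, L₂, D, hM⟩ := Matrix.Pivot.exists_list_transvec_mul_diagonal_mul_list_transvec M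
  set P := (L₁.map TransvectionStruct.toMatrix).prod
  set Q := (L₂.map TransvectionStruct.toMatrix).prod
  have hP : P.det = 1 := TransvectionStruct.det_toMatrix_prod _
  have hQ : Q.det = 1 := TransvectionStruct.det_toMatrix_prod _
  have hmap : M.map g = P.map g * diagonal (fun i => g (D i)) * Q.map g := by
    rw [hM, Matrix.map_mul, Matrix.map_mul, diagonal_map (map_zero g)]
  have hPg : (P.map g).det = 1 := by
    rw [← RingHom.mapMatrix_apply, ← RingHom.map_det, hP, map_one]
  have hQg : (Q.map g).det = 1 := by
    rw [← RingHom.mapMatrix_apply, ← RingHom.map_det, hQ, map_one]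
  rw [hmap, hM, rank_mul_eq_left_of_isUnit_det _ _ (by rw [hQg]; exact isUnit_one),
    rank_mul_eq_right_of_isUnit_det _ _ (by rw [hPg]; exact isUnit_one),
    rank_mul_eq_left_of_isUnit_det _ _ (by rw [hQ]; exact isUnit_one),
    rank_mul_eq_right_of_isUnit_det _ _ (by rw [hP]; exact isUnit_one),
    rank_diagonal, rank_diagonal]
  simp

theorem det_eq_zero_of_rank_lt {M : Matrix (Fin n) (Fin n) K} (h : M.rank < n) : M.det = 0 := by
  by_contra h0
  have := rank_of_det_ne_zero h0
  simp at this
  omega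

end Rank

section Necessity

variable {R K : Type*} [CommRing R] [Field K] [Algebra R K]
  [IsFractionRing R K] {n : ℕ}

theorem dvd_of_sub_map_rank_lt [IsIntegrallyClosed R] {m : ℕ} {a d : R} (ha : a ≠ 0) {h : Fin m → R}
    (hh : ∀ k, h k ≠ 0) (W : Matrix (Fin m) (Fin m) R)
    (hr : (diagonal (fun k => algebraMap R K d / algebraMap R K (a * h k))
      - W.map (algebraMap R K)).rank < m) : a ∣ d := by
  have ha' : algebraMap R K a ≠ 0 := by simpa using ha
  have hh' : ∀ k, algebraMap R K (h k) ≠ 0 := fun k => by simpa using hh k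
  set x : K := algebraMap R K d / algebraMap R K a with hx
  have h1 : (diagonal (fun k => algebraMap R K d / algebraMap R K (a * h k))
      - W.map (algebraMap R K)) * diagonal (fun k => algebraMap R K (h k))
      = Matrix.scalar (Fin m) x - (W * diagonal h).map (algebraMap R K) := by
    rw [sub_mul, diagonal_mul_diagonal, Matrix.map_mul, diagonal_map (map_zero _)]
    congr 1
    rw [scalar_apply]
    congr 1
    ext k
    rw [hx, map_mul]
    have := hh' k
    field_simp
  have h2 := det_eq_zero_of_rank_lt ((rank_mul_le_left _
    (diagonal (fun k => algebraMap R K (h k)))).trans_lt hr)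
  rw [h1, ← eval_charpoly] at h2
  have h3 : IsIntegral R x := by
    refine ⟨(W * diagonal h).charpoly, charpoly_monic _, ?_⟩
    have h4 : ((W * diagonal h).map (algebraMap R K)).charpoly
      = (W * diagonal h).charpoly.map (algebraMap R K) := charpoly_map _ _
    rwa [h4, eval_map] at h2
  obtain ⟨y, hy⟩ := IsIntegrallyClosed.isIntegral_iff.1 h3
  refine ⟨y, IsFractionRing.injective R K ?_⟩
  rw [map_mul, hy, hx]
  field_simp

theorem card_filter_gt (l : ℕ) :
    (Finset.univ.filter fun k : Fin n => l < k).card = n - 1 - l := by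
  have : (Finset.univ.filter fun k : Fin n => l < k).map Fin.valEmbedding
      = Finset.Ioo l n := by
    ext x
    simp only [Finset.mem_map, Finset.mem_filter, Finset.mem_univ, true_and, Finset.mem_Ioo,
      Fin.valEmbedding_apply]
    exact ⟨fun ⟨k, hk, hx⟩ => hx ▸ ⟨hk, k.2⟩, fun ⟨h1, h2⟩ => ⟨⟨x, h2⟩, h1, rfl⟩⟩
  rw [← Finset.card_map, this, Nat.card_Ioo]
  omega

theorem exists_diagonal_eq_map_add [IsDomain R] {g : ℕ → R} (hg : ∀ i, i + 1 < n → g i ∣ g (i + 1))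
    (hg0 : ∀ i < n, g i ≠ 0) {l : ℕ} (hl : l < n) :
    ∃ (W : Matrix (Fin n) (Fin n) R) (Z : Matrix (Fin n) (Fin n) K), Z.rank ≤ n - 1 - l ∧
      diagonal (fun k : Fin n => algebraMap R K (g l) / algebraMap R K (g k))
        = W.map (algebraMap R K) + Z := by
  classical
  have hdiv : ∀ k : ℕ, k ≤ l → ∃ q, g l = g k * q := fun k hk => dvd_of_chain hg hk hl
  choose! q hq using hdiv
  refine ⟨diagonal fun k : Fin n => if (k : ℕ) ≤ l then q k else 0,
    diagonal fun k : Fin n => if (k : ℕ) ≤ l then 0 else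
      algebraMap R K (g l) / algebraMap R K (g k), ?_, ?_⟩
  · rw [rank_diagonal, ← card_filter_gt (n := n) l, Fintype.card_subtype]
    refine Finset.card_le_card fun k hk => ?_
    simp only [Finset.mem_filter, Finset.mem_univ, true_and] at hk ⊢
    by_contra hkl
    exact hk (if_pos (by omega))
  · rw [diagonal_map (map_zero _), diagonal_add]
    congr 1
    ext k
    have h0 : algebraMap R K (g k) ≠ 0 := by simpa using hg0 k k.2
    by_cases hk : (k : ℕ) ≤ l
    · simp only [if_pos hk, add_zero]
      rw [hq k hk, map_mul]
      field_simp
    · simp [if_neg hk]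

theorem dvd_of_rank_le [IsDomain R] [IsIntegrallyClosed R] {r : ℕ} {f g : ℕ → R}
    (hf : ∀ i, i + 1 < n → f i ∣ f (i + 1))
    (hg : ∀ i, i + 1 < n → g i ∣ g (i + 1)) (hf0 : ∀ i < n, f i ≠ 0) (hg0 : ∀ i < n, g i ≠ 0)
    {X Y : Matrix (Fin n) (Fin n) R} (hX : IsUnit X.det) (hY : IsUnit Y.det)
    (hr : ((X * diagonal (fun i : Fin n => g i) * Y - diagonal fun i : Fin n => f i).map
      (algebraMap R K)).rank ≤ r) (i : ℕ) (hi : i + r < n) : f i ∣ g (i + r) := by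
  set ι := algebraMap R K with hι
  obtain ⟨W, Z, hZ, hWZ⟩ := exists_diagonal_eq_map_add (K := K) hg hg0 hi
  set d := g (i + r) with hd
  have hf' : ∀ k : Fin n, ι (f k) ≠ 0 := fun k => by simpa [hι] using hf0 k k.2
  have hg' : ∀ k : Fin n, ι (g k) ≠ 0 := fun k => by simpa [hι] using hg0 k k.2
  set Df : Matrix (Fin n) (Fin n) K := diagonal fun k => ι (f k) with hDf
  set Dg : Matrix (Fin n) (Fin n) K := diagonal fun k => ι (g k) with hDg
  set Df' : Matrix (Fin n) (Fin n) K := diagonal fun k => ι d / ι (f k) with hDf'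
  set Dg' : Matrix (Fin n) (Fin n) K := diagonal fun k => ι d / ι (g k) with hDg'
  have hff : Df' * Df = ι d • 1 := by
    rw [hDf, hDf', diagonal_mul_diagonal, ← diagonal_one, ← diagonal_smul]
    congr 1
    ext k
    have := hf' k
    simp only [Pi.smul_apply, smul_eq_mul]
    field_simp
  have hgg : Dg * Dg' = ι d • 1 := by
    rw [hDg, hDg', diagonal_mul_diagonal, ← diagonal_one, ← diagonal_smul]
    congr 1
    ext k
    have := hg' k
    simp only [Pi.smul_apply, smul_eq_mul]
    field_simp
  have hd0 : ι d ≠ 0 := by simpa [hι] using hg0 _ hi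
  have hXX : X.map ι * X⁻¹.map ι = 1 := by
    rw [← Matrix.map_mul, mul_nonsing_inv _ hX, Matrix.map_one _ (map_zero _) (map_one _)]
  have hYY : Y.map ι * Y⁻¹.map ι = 1 := by
    rw [← Matrix.map_mul, mul_nonsing_inv _ hY, Matrix.map_one _ (map_zero _) (map_one _)]
  set E := X.map ι * Dg * Y.map ι - Df with hE
  have hEr : E.rank ≤ r := by
    have : (X * diagonal (fun i : Fin n => g i) * Y - diagonal fun i : Fin n => f i).map ι
        = E := by
      rw [Matrix.map_sub _ (map_sub ι), Matrix.map_mul, Matrix.map_mul, diagonal_map (map_zero _),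
        diagonal_map (map_zero _)]
    rwa [← this]
  have hmain : ι d • (Df' - Y⁻¹.map ι * Dg' * X⁻¹.map ι)
      = Df' * E * (Y⁻¹.map ι * Dg' * X⁻¹.map ι) := by
    have h1 : X.map ι * Dg * Y.map ι * (Y⁻¹.map ι * Dg' * X⁻¹.map ι) = ι d • 1 := by
      calc _ = X.map ι * (Dg * (Y.map ι * Y⁻¹.map ι) * Dg') * X⁻¹.map ι := by
            simp only [Matrix.mul_assoc]
        _ = _ := by rw [hYY, Matrix.mul_one, hgg, Matrix.mul_smul, Matrix.mul_one, Matrix.smul_mul, hXX]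
    rw [hE, Matrix.mul_sub, Matrix.sub_mul, Matrix.mul_assoc Df', h1, hff, Matrix.mul_smul,
      Matrix.mul_one, Matrix.smul_mul, Matrix.one_mul, smul_sub]
  have hZ' : (Df' - (Y⁻¹ * W * X⁻¹).map ι).rank ≤ n - 1 - i := by
    have h1 : Df' - (Y⁻¹ * W * X⁻¹).map ι
        = (Df' - Y⁻¹.map ι * Dg' * X⁻¹.map ι) + Y⁻¹.map ι * Z * X⁻¹.map ι := by
      rw [hWZ, Matrix.map_mul, Matrix.map_mul, Matrix.mul_add, Matrix.add_mul]
      abel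
    have h2 : (Df' - Y⁻¹.map ι * Dg' * X⁻¹.map ι).rank ≤ r := by
      rw [← rank_smul_of_mem_nonZeroDivisors _ (mem_nonZeroDivisors_of_ne_zero hd0), hmain]
      exact (rank_mul_le_left _ _).trans ((rank_mul_le_right _ _).trans hEr)
    have h3 : (Y⁻¹.map ι * Z * X⁻¹.map ι).rank ≤ n - 1 - (i + r) :=
      (rank_mul_le_left _ _).trans ((rank_mul_le_right _ _).trans hZ)
    rw [h1]
    have := rank_add_le' (Df' - Y⁻¹.map ι * Dg' * X⁻¹.map ι) (Y⁻¹.map ι * Z * X⁻¹.map ι)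
    omega
  obtain ⟨m, hm⟩ : ∃ m, n = i + m := ⟨n - i, by omega⟩
  let c : Fin m → Fin n := fun k => ⟨i + k, by omega⟩
  have hc : Function.Injective c := fun a b hab => by
    have := congrArg Fin.val hab
    simp only [c] at this
    exact Fin.ext (by omega)
  have hdiv : ∀ k : Fin m, ∃ q, f (i + k) = f i * q := fun k =>
    dvd_of_chain hf (by omega) (by omega)
  choose h hh using hdiv
  refine dvd_of_sub_map_rank_lt (K := K) (hf0 i (by omega)) (h := h) (fun k h0 => ?_)
    ((Y⁻¹ * W * X⁻¹).submatrix c c) ?_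
  · exact hf0 (i + k) (by omega) (by rw [hh, h0, mul_zero])
  · have h1 : diagonal (fun k => ι d / ι (f i * h k))
        - ((Y⁻¹ * W * X⁻¹).submatrix c c).map ι
        = (Df' - (Y⁻¹ * W * X⁻¹).map ι).submatrix c c := by
      rw [submatrix_sub, hDf', Pi.sub_apply, Pi.sub_apply, submatrix_diagonal _ _ hc]
      congr 1
      congr 1
      ext k
      simp [c, ← hh]
    rw [h1]
    refine ((rank_submatrix_le _ _ _).trans hZ').trans_lt ?_
    omega

end Necessity

section Counting

/-- The sequence delayed by `k` steps and preceded by `e`. -/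
def delay {α : Type*} (e : α) (k : ℕ) (a : ℕ → α) (j : ℕ) : α := if j < k then e else a (j - k)

theorem exists_threshold {n : ℕ} {p : ℕ → Prop} (hp : ∀ i, i + 1 < n → p i → p (i + 1)) :
    ∃ A ≤ n, ∀ i < n, p i ↔ A ≤ i := by
  classical
  have hex : ∃ i, n ≤ i ∨ p i := ⟨n, Or.inl le_rfl⟩
  refine ⟨Nat.find hex, Nat.find_min' hex (Or.inl le_rfl), fun i hi =>
    ⟨fun h => Nat.find_min' hex (Or.inr h), fun h => ?_⟩⟩
  induction i, h using Nat.le_induction with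
  | base => exact (Nat.find_spec hex).resolve_left (by omega)
  | succ i _ ih => exact hp i hi (ih (by omega))

theorem card_filter_le (n A : ℕ) : ((Finset.range n).filter fun i => A ≤ i).card = n - A := by
  have : (Finset.range n).filter (fun i => A ≤ i) = Finset.Ico A n := by
    ext i
    simp [and_comm]
  rw [this, Nat.card_Ico]

theorem card_level_le {n r : ℕ} {p q : ℕ → Prop} [DecidablePred p] [DecidablePred q]
    (hp : ∀ i, i + 1 < n → p i → p (i + 1)) (hq : ∀ i, i + 1 < n → q i → q (i + 1))
    (hpq : ∀ i, i + (r + 1) < n → (p i → q (i + (r + 1))) ∧ (q i → p (i + (r + 1)))) :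
    (r + 1) * ((Finset.range n).filter fun j => (1 ≤ j ∧ p (j - 1)) ∨ (r ≤ j ∧ q (j - r))).card
      ≤ r * ((Finset.range n).filter p).card + ((Finset.range n).filter q).card := by
  obtain ⟨A, hA, hAp⟩ := exists_threshold hp
  obtain ⟨B, hB, hBq⟩ := exists_threshold hq
  have h1 : (Finset.range n).filter p = (Finset.range n).filter (A ≤ ·) :=
    Finset.filter_congr fun i hi => hAp i (Finset.mem_range.1 hi)
  have h2 : (Finset.range n).filter q = (Finset.range n).filter (B ≤ ·) :=
    Finset.filter_congr fun i hi => hBq i (Finset.mem_range.1 hi)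
  have h3 : (Finset.range n).filter (fun j => (1 ≤ j ∧ p (j - 1)) ∨ (r ≤ j ∧ q (j - r)))
      = (Finset.range n).filter (min (A + 1) (B + r) ≤ ·) := by
    refine Finset.filter_congr fun j hj => ?_
    have hj' := Finset.mem_range.1 hj
    rw [hAp _ (by omega), hBq _ (by omega)]
    omega
  rw [h1, h2, h3, card_filter_le, card_filter_le, card_filter_le]
  have hAB : B ≤ A + (r + 1) := by
    by_contra hlt
    have := ((hpq A (by omega)).1 ((hAp A (by omega)).2 le_rfl))
    have := (hBq _ (by omega)).1 this
    omega
  have hBA : A ≤ B + (r + 1) := by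
    by_contra hlt
    have := ((hpq B (by omega)).2 ((hBq B (by omega)).2 le_rfl))
    have := (hAp _ (by omega)).1 this
    omega
  obtain ⟨x, hx⟩ := Nat.exists_eq_add_of_le hA
  obtain ⟨y, hy⟩ := Nat.exists_eq_add_of_le hB
  have e1 : n - A = x := by omega
  have e2 : n - B = y := by omega
  rw [e1, e2]
  have h4 : n - min (A + 1) (B + r) ≤ x - 1 ∨ n - min (A + 1) (B + r) ≤ y - r := by omega
  rcases h4 with h4 | h4
  · refine (Nat.mul_le_mul_left _ h4).trans ?_
    rcases Nat.eq_zero_or_pos x with rfl | hx0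
    · simp
    · obtain ⟨x, rfl⟩ : ∃ z, x = z + 1 := ⟨x - 1, by omega⟩
      rw [Nat.add_sub_cancel]
      have : x ≤ y + r := by omega
      nlinarith
  · refine (Nat.mul_le_mul_left _ h4).trans ?_
    rcases Nat.lt_or_ge y r with hyr | hyr
    · simp [Nat.sub_eq_zero_of_le hyr.le]
    · obtain ⟨z, rfl⟩ := Nat.exists_eq_add_of_le hyr
      rw [Nat.add_sub_cancel_left]
      have : z ≤ x + 1 := by omega
      nlinarith

theorem sum_eq_sum_card_level {n N : ℕ} {x : ℕ → ℕ} (hx : ∀ i < n, x i ≤ N) :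
    ∑ i ∈ Finset.range n, x i
      = ∑ k ∈ Finset.range N, ((Finset.range n).filter fun i => k < x i).card := by
  simp_rw [Finset.card_filter]
  rw [Finset.sum_comm]
  refine Finset.sum_congr rfl fun i hi => ?_
  rw [← Finset.card_filter]
  have : (Finset.range N).filter (fun k => k < x i) = Finset.range (x i) := by
    ext k
    have := hx i (Finset.mem_range.1 hi)
    simp only [Finset.mem_filter, Finset.mem_range]
    omega
  rw [this, Finset.card_range]

theorem sum_max_delay_le {n r : ℕ} {a b : ℕ → ℕ} (ha : ∀ i, i + 1 < n → a i ≤ a (i + 1))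
    (hb : ∀ i, i + 1 < n → b i ≤ b (i + 1))
    (hab : ∀ i, i + (r + 1) < n → a i ≤ b (i + (r + 1)) ∧ b i ≤ a (i + (r + 1))) :
    (r + 1) * ∑ j ∈ Finset.range n, max (delay 0 1 a j) (delay 0 r b j)
      ≤ r * ∑ j ∈ Finset.range n, a j + ∑ j ∈ Finset.range n, b j := by
  set N := ∑ j ∈ Finset.range n, a j + ∑ j ∈ Finset.range n, b j with hN
  have haN : ∀ i < n, a i ≤ N := fun i hi =>
    (Finset.single_le_sum (fun _ _ => Nat.zero_le _) (Finset.mem_range.2 hi)).trans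
      (Nat.le_add_right _ _)
  have hbN : ∀ i < n, b i ≤ N := fun i hi =>
    (Finset.single_le_sum (fun _ _ => Nat.zero_le _) (Finset.mem_range.2 hi)).trans
      (Nat.le_add_left _ _)
  rw [sum_eq_sum_card_level haN, sum_eq_sum_card_level hbN,
    sum_eq_sum_card_level (N := N) (x := fun j => max (delay 0 1 a j) (delay 0 r b j)),
    Finset.mul_sum, Finset.mul_sum, ← Finset.sum_add_distrib]
  · refine Finset.sum_le_sum fun k _ => ?_
    have key := @card_level_le n r (fun i => k < a i) (fun i => k < b i) inferInstance inferInstance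
      (fun i hi h => h.trans_le (ha i hi)) (fun i hi h => h.trans_le (hb i hi))
      (fun i hi => ⟨fun h => h.trans_le (hab i hi).1, fun h => h.trans_le (hab i hi).2⟩)
    refine le_of_eq_of_le (congrArg _ (congrArg _ (Finset.filter_congr fun j _ => ?_))) key
    simp only [delay, lt_max_iff]
    split_ifs <;> omega
  · intro i hi
    simp only [delay]
    refine max_le ?_ ?_ <;> split_ifs
    · exact Nat.zero_le _
    · exact haN _ (by omega)
    · exact Nat.zero_le _
    · exact hbN _ (by omega)

end Counting

section IntermediateChain

open UniqueFactorizationMonoid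
open scoped Classical

variable {F : Type*} [Field F] {n r : ℕ}

/-- A least common multiple, defined through the multisets of prime factors. -/
noncomputable def factorsLcm (f g : F[X]) : F[X] :=
  (normalizedFactors f ∪ normalizedFactors g).prod

theorem natDegree_eq_sum_normalizedFactors {f : F[X]} (hf : f ≠ 0) :
    f.natDegree = ((normalizedFactors f).map natDegree).sum := by
  have h0 : (0 : F[X]) ∉ normalizedFactors f := zero_notMem_normalizedFactors f
  rw [← natDegree_multiset_prod _ h0]
  exact (natDegree_eq_of_degree_eq (degree_eq_degree_of_associated (prod_normalizedFactors hf))).symm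

theorem dvd_prod_of_normalizedFactors_le {f : F[X]} (hf : f ≠ 0) {s : Multiset F[X]}
    (h : normalizedFactors f ≤ s) : f ∣ s.prod :=
  (prod_normalizedFactors hf).symm.dvd.trans (Multiset.prod_dvd_prod_of_le h)

theorem left_dvd_factorsLcm {f g : F[X]} (hf : f ≠ 0) : f ∣ factorsLcm f g := by
  exact dvd_prod_of_normalizedFactors_le hf Multiset.le_union_left

theorem right_dvd_factorsLcm {f g : F[X]} (hg : g ≠ 0) : g ∣ factorsLcm f g := by
  exact dvd_prod_of_normalizedFactors_le hg Multiset.le_union_right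

theorem factorsLcm_dvd {f g h : F[X]} (hf : f ≠ 0) (hg : g ≠ 0) (hh : h ≠ 0) (h1 : f ∣ h)
    (h2 : g ∣ h) : factorsLcm f g ∣ h := by
  refine (Multiset.prod_dvd_prod_of_le (Multiset.union_le
    ((dvd_iff_normalizedFactors_le_normalizedFactors hf hh).1 h1)
    ((dvd_iff_normalizedFactors_le_normalizedFactors hg hh).1 h2))).trans
    (prod_normalizedFactors hh).dvd

theorem factorsLcm_ne_zero (f g : F[X]) : factorsLcm f g ≠ 0 := by
  refine Multiset.prod_ne_zero fun h => ?_
  rcases Multiset.mem_union.1 h with h | h <;> exact zero_notMem_normalizedFactors _ h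

theorem natDegree_factorsLcm (f g : F[X]) : (factorsLcm f g).natDegree
    = ((normalizedFactors f ∪ normalizedFactors g).map natDegree).sum := by
  rw [← natDegree_multiset_prod]
  · rw [factorsLcm]
  · intro h
    rcases Multiset.mem_union.1 h with h | h <;> exact zero_notMem_normalizedFactors _ h

theorem sum_natDegree_factorsLcm_le {f g : ℕ → F[X]} (hf0 : ∀ i < n, f i ≠ 0)
    (hg0 : ∀ i < n, g i ≠ 0) (hf : ∀ i, i + 1 < n → f i ∣ f (i + 1))
    (hg : ∀ i, i + 1 < n → g i ∣ g (i + 1)) (h : ShiftDvd n (r + 1) f g) :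
    (r + 1) * ∑ j ∈ Finset.range n, (factorsLcm (delay 1 1 f j) (delay 1 r g j)).natDegree
      ≤ r * ∑ j ∈ Finset.range n, (f j).natDegree + ∑ j ∈ Finset.range n, (g j).natDegree := by
  let S : Multiset F[X] →+ ℕ :=
    Multiset.sumAddMonoidHom.comp (Multiset.mapAddMonoidHom natDegree)
  have hS : ∀ s t : Multiset F[X], s ≤ t → S s ≤ S t := by
    intro s t hst
    obtain ⟨u, rfl⟩ := Multiset.le_iff_exists_add.1 hst
    rw [map_add]
    exact Nat.le_add_right _ _
  have e1 : ∀ j, (factorsLcm (delay 1 1 f j) (delay 1 r g j)).natDegree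
      = S (normalizedFactors (delay 1 1 f j) ∪ normalizedFactors (delay 1 r g j)) :=
    fun j => natDegree_factorsLcm _ _
  have e2 : ∑ j ∈ Finset.range n, (f j).natDegree
      = ∑ j ∈ Finset.range n, S (normalizedFactors (f j)) :=
    Finset.sum_congr rfl fun j hj =>
      natDegree_eq_sum_normalizedFactors (hf0 j (Finset.mem_range.1 hj))
  have e3 : ∑ j ∈ Finset.range n, (g j).natDegree
      = ∑ j ∈ Finset.range n, S (normalizedFactors (g j)) :=
    Finset.sum_congr rfl fun j hj =>
      natDegree_eq_sum_normalizedFactors (hg0 j (Finset.mem_range.1 hj))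
  simp_rw [e1]
  rw [e2, e3, ← map_sum, ← map_sum, ← map_sum, ← smul_eq_mul, ← smul_eq_mul, ← map_nsmul,
    ← map_nsmul, ← map_add]
  refine hS _ _ (Multiset.le_iff_count.2 fun p => ?_)
  have hle : ∀ {x y : F[X]}, x ≠ 0 → y ≠ 0 → x ∣ y →
      (normalizedFactors x).count p ≤ (normalizedFactors y).count p := fun hx hy hxy =>
    Multiset.le_iff_count.1 ((dvd_iff_normalizedFactors_le_normalizedFactors hx hy).1 hxy) p
  have := sum_max_delay_le (n := n) (r := r) (a := fun j => (normalizedFactors (f j)).count p)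
    (b := fun j => (normalizedFactors (g j)).count p)
    (fun i hi => hle (hf0 _ (by omega)) (hf0 _ hi) (hf i hi))
    (fun i hi => hle (hg0 _ (by omega)) (hg0 _ hi) (hg i hi))
    (fun i hi => ⟨hle (hf0 _ (by omega)) (hg0 _ hi) (h i hi).1,
      hle (hg0 _ (by omega)) (hf0 _ hi) (h i hi).2⟩)
  have hdel : ∀ (k : ℕ) (x : ℕ → F[X]) (j : ℕ), (normalizedFactors (delay 1 k x j)).count p
      = delay 0 k (fun j => (normalizedFactors (x j)).count p) j := by
    intro k x j
    simp only [delay]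
    split_ifs <;> simp
  simpa only [Multiset.count_add, Multiset.count_nsmul, Multiset.count_sum', Multiset.count_union,
    hdel] using this

theorem exists_intermediate_chain {f g : ℕ → F[X]} (hf : IsFactorChain n f)
    (hg : IsFactorChain n g) (hr : 1 ≤ r) (h : ShiftDvd n (r + 1) f g) :
    ∃ χ, IsFactorChain n χ ∧ ShiftDvd n 1 f χ ∧ ShiftDvd n r χ g := by
  rcases Nat.eq_zero_or_pos n with rfl | hn
  · exact ⟨f, hf, fun i hi => absurd hi (by omega), fun i hi => absurd hi (by omega)⟩
  obtain ⟨m, rfl⟩ : ∃ m, n = m + 1 := ⟨n - 1, by omega⟩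
  set L : ℕ → F[X] := fun j => factorsLcm (delay 1 1 f j) (delay 1 r g j) with hL
  have hL0 : ∀ j, L j ≠ 0 := fun j => factorsLcm_ne_zero _ _
  have hdf : ∀ j ≤ m, delay 1 1 f j ≠ 0 := fun j hj => by
    simp only [delay]
    split_ifs
    · exact one_ne_zero
    · exact hf.ne_zero _ (by omega)
  have hdg : ∀ j ≤ m, delay 1 r g j ≠ 0 := fun j hj => by
    simp only [delay]
    split_ifs
    · exact one_ne_zero
    · exact hg.ne_zero _ (by omega)
  have hfL : ∀ j < m, f j ∣ L (j + 1) := fun j hj => by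
    have e : delay 1 1 f (j + 1) = f j := by simp [delay]
    have : delay 1 1 f (j + 1) ∣ L (j + 1) := left_dvd_factorsLcm (hdf (j + 1) hj)
    rwa [e] at this
  have hgL : ∀ j, j + r ≤ m → g j ∣ L (j + r) := fun j hj => by
    have e : delay 1 r g (j + r) = g j := by simp [delay]
    have : delay 1 r g (j + r) ∣ L (j + r) := right_dvd_factorsLcm (hdg (j + r) hj)
    rwa [e] at this
  have hLf : ∀ j < m, L j ∣ f (j + 1) := fun j hj => by
    refine factorsLcm_dvd (hdf j hj.le) (hdg j hj.le) (hf.ne_zero _ (by omega)) ?_ ?_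
    · simp only [delay]
      split_ifs
      · exact one_dvd _
      · exact dvd_of_chain hf.chain (by omega) (by omega)
    · simp only [delay]
      split_ifs
      · exact one_dvd _
      · have := (h (j - r) (by omega)).2
        rwa [show j - r + (r + 1) = j + 1 by omega] at this
  have hLg : ∀ j, j + r ≤ m → L j ∣ g (j + r) := fun j hj => by
    refine factorsLcm_dvd (hdf j (by omega)) (hdg j (by omega)) (hg.ne_zero _ (by omega)) ?_ ?_
    · simp only [delay]
      split_ifs
      · exact one_dvd _
      · have := (h (j - 1) (by omega)).1
        rwa [show j - 1 + (r + 1) = j + r by omega] at this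
    · simp only [delay]
      split_ifs
      · exact one_dvd _
      · exact dvd_of_chain hg.chain (by omega) (by omega)
  have hLL : ∀ j < m, L j ∣ L (j + 1) := fun j hj => by
    refine factorsLcm_dvd (hdf j hj.le) (hdg j hj.le) (hL0 _) ?_ ?_
    · simp only [delay]
      split_ifs
      · exact one_dvd _
      · exact (dvd_of_chain hf.chain (by omega) (by omega)).trans (hfL j hj)
    · simp only [delay]
      split_ifs
      · exact one_dvd _
      · have := hgL (j - r + 1) (by omega)
        rw [show j - r + 1 + r = j + 1 by omega] at this
        exact (dvd_of_chain hg.chain (by omega) (by omega)).trans this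
  have hsum : ∑ j ∈ Finset.range (m + 1), (L j).natDegree ≤ m + 1 := by
    have := sum_natDegree_factorsLcm_le hf.ne_zero hg.ne_zero hf.chain hg.chain h
    rw [hf.sum_natDegree, hg.sum_natDegree] at this
    refine Nat.le_of_mul_le_mul_left (this.trans (le_of_eq ?_)) (Nat.succ_pos r)
    ring
  set e := m + 1 - ∑ j ∈ Finset.range (m + 1), (L j).natDegree with he
  refine ⟨fun j => if j < m then L j else L j * X ^ e, ⟨fun i hi => ?_, fun i hi => ?_, ?_⟩,
    fun i hi => ?_, fun i hi => ?_⟩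
  · simp only [if_pos (show i < m by omega)]
    split_ifs
    · exact hLL i (by omega)
    · exact (hLL i (by omega)).mul_right _
  · split_ifs
    · exact hL0 _
    · exact mul_ne_zero (hL0 _) (pow_ne_zero _ X_ne_zero)
  · rw [Finset.sum_range_succ] at he hsum ⊢
    have : ∑ j ∈ Finset.range m, (if j < m then L j else L j * X ^ e).natDegree
        = ∑ j ∈ Finset.range m, (L j).natDegree :=
      Finset.sum_congr rfl fun j hj => by rw [if_pos (Finset.mem_range.1 hj)]
    rw [this, if_neg (lt_irrefl m), natDegree_mul (hL0 _) (pow_ne_zero _ X_ne_zero),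
      natDegree_X_pow]
    omega
  · constructor
    · dsimp only
      split_ifs
      · exact hfL i (by omega)
      · exact (hfL i (by omega)).mul_right _
    · dsimp only
      rw [if_pos (by omega)]
      exact hLf i (by omega)
  · constructor
    · dsimp only
      rw [if_pos (by omega)]
      exact hLg i (by omega)
    · dsimp only
      split_ifs
      · exact hgL i (by omega)
      · exact (hgL i (by omega)).mul_right _

end IntermediateChain

section Near

universe u v

variable {F : Type v} [Field F] {V V' V'' : Type u} [AddCommGroup V] [AddCommGroup V']
  [AddCommGroup V''] [Module F V] [Module F V'] [Module F V'']

/-- Two endomorphisms are `r`-near if some conjugates of them differ by an endomorphism of rank at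
most `r`. -/
def Near (r : ℕ) (T : Module.End F V) (T' : Module.End F V') : Prop :=
  ∃ Θ : V ≃ₗ[F] V', LinearMap.rank (Θ.toLinearMap ∘ₗ T - T' ∘ₗ Θ.toLinearMap) ≤ r

theorem Near.trans {a b : ℕ} {T : Module.End F V} {T' : Module.End F V'} {T'' : Module.End F V''}
    (h : Near a T T') (h' : Near b T' T'') : Near (b + a) T T'' := by
  obtain ⟨Θ, h⟩ := h
  obtain ⟨Θ', h'⟩ := h'
  refine ⟨Θ.trans Θ', ?_⟩
  have e : (Θ.trans Θ').toLinearMap ∘ₗ T - T'' ∘ₗ (Θ.trans Θ').toLinearMap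
      = (Θ'.toLinearMap ∘ₗ T' - T'' ∘ₗ Θ'.toLinearMap) ∘ₗ Θ.toLinearMap
        + Θ'.toLinearMap ∘ₗ (Θ.toLinearMap ∘ₗ T - T' ∘ₗ Θ.toLinearMap) := by
    ext x
    simp
  rw [e, Nat.cast_add]
  exact (LinearMap.rank_add_le _ _).trans (add_le_add
    ((LinearMap.rank_comp_le_left _ _).trans h') ((LinearMap.rank_comp_le_right _ _).trans h))

theorem near_zero_of_semiconj {T : Module.End F V} {T' : Module.End F V'} (e : V ≃ₗ[F] V')
    (h : ∀ x, e (T x) = T' (e x)) : Near 0 T T' := by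
  refine ⟨e, ?_⟩
  have : e.toLinearMap ∘ₗ T - T' ∘ₗ e.toLinearMap = 0 := by
    ext x
    simp [h]
  rw [this, LinearMap.rank_zero]
  simp

/-- Multiplication by `X` as an `F`-linear endomorphism. -/
noncomputable def mulX (F : Type*) [Field F] (M : Type*) [AddCommGroup M] [Module F M]
    [Module F[X] M] [IsScalarTower F F[X] M] : Module.End F M :=
  Algebra.lsmul F F M (X : F[X])

variable [Module F[X] V] [IsScalarTower F F[X] V] [Module F[X] V'] [IsScalarTower F F[X] V']

@[simp] theorem mulX_apply (x : V) : mulX F V x = (X : F[X]) • x := rfl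

theorem near_zero_of_linearEquiv (e : V ≃ₗ[F[X]] V') : Near 0 (mulX F V) (mulX F V') :=
  near_zero_of_semiconj (e.restrictScalars F) fun x => map_smul e (X : F[X]) x

variable {N : Type*} [AddCommGroup N] [Module F N] [Module F[X] N] [IsScalarTower F F[X] N]

/-- The map `(x, p) ↦ ι x + p • u` with `p` running over the polynomials of degree less
than `m`. -/
noncomputable def coprodDegreeLT (ι : N →ₗ[F[X]] V) (u : V) (m : ℕ) :
    N × degreeLT F m →ₗ[F] V :=
  (ι.restrictScalars F).coprod
    (((LinearMap.toSpanSingleton F[X] V u).restrictScalars F) ∘ₗ (degreeLT F m).subtype)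

theorem coprodDegreeLT_apply (ι : N →ₗ[F[X]] V) (u : V) (m : ℕ) (x : N × degreeLT F m) :
    coprodDegreeLT ι u m x = ι x.1 + (x.2 : F[X]) • u := by
  simp [coprodDegreeLT]

theorem X_mul_sub_mem_degreeLT {m : ℕ} {p : F[X]} (hp : p ∈ degreeLT F m) :
    X * p - C ((X * p).coeff m) * X ^ m ∈ degreeLT F m := by
  rw [mem_degreeLT, degree_lt_iff_coeff_zero] at hp ⊢
  intro k hk
  rcases hk.eq_or_lt with rfl | hk
  · simp
  · obtain ⟨k, rfl⟩ : ∃ j, k = j + 1 := ⟨k - 1, by omega⟩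
    have h1 := hp k (by omega)
    have h2 : k + 1 ≠ m := by omega
    simp [coeff_X_mul, coeff_X_pow, h1, h2]

theorem near_one_of_bijective {ι : N →ₗ[F[X]] V} {ι' : N →ₗ[F[X]] V'} {u : V} {u' : V'} {m : ℕ}
    (h : Function.Bijective (coprodDegreeLT ι u m))
    (h' : Function.Bijective (coprodDegreeLT ι' u' m)) : Near 1 (mulX F V) (mulX F V') := by
  set Ψ := LinearEquiv.ofBijective _ h
  set Ψ' := LinearEquiv.ofBijective _ h'
  set Θ := Ψ.symm.trans Ψ' with hΘ
  have hΘa : ∀ (x : N) (p : F[X]), p ∈ degreeLT F m → Θ (ι x + p • u) = ι' x + p • u' := by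
    intro x p hp
    have e : Ψ (x, ⟨p, hp⟩) = ι x + p • u := coprodDegreeLT_apply _ _ _ _
    rw [← e, hΘ, LinearEquiv.trans_apply, LinearEquiv.symm_apply_apply]
    exact coprodDegreeLT_apply _ _ _ _
  refine ⟨Θ, ?_⟩
  set w : V' := Θ ((X ^ m : F[X]) • u) - (X ^ m : F[X]) • u'
  have hle : LinearMap.range (Θ.toLinearMap ∘ₗ mulX F V - mulX F V' ∘ₗ Θ.toLinearMap)
      ≤ Submodule.span F {w} := by
    rintro _ ⟨z, rfl⟩
    obtain ⟨⟨x, p, hp⟩, rfl⟩ := Ψ.surjective z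
    have e : Ψ (x, ⟨p, hp⟩) = ι x + p • u := coprodDegreeLT_apply _ _ _ _
    refine Submodule.mem_span_singleton.2 ⟨(X * p).coeff m, ?_⟩
    set c := (X * p).coeff m
    have hq := X_mul_sub_mem_degreeLT hp
    have h1 : (X : F[X]) • (ι x + p • u)
        = (ι ((X : F[X]) • x) + (X * p - C c * X ^ m) • u) + c • ((X ^ m : F[X]) • u) := by
      rw [smul_add, map_smul, sub_smul, mul_smul, mul_smul, C_eq_algebraMap, algebraMap_smul]
      abel
    have h2 : (X : F[X]) • (ι' x + p • u')
        = (ι' ((X : F[X]) • x) + (X * p - C c * X ^ m) • u') + c • ((X ^ m : F[X]) • u') := by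
      rw [smul_add, map_smul, sub_smul, mul_smul, mul_smul, C_eq_algebraMap, algebraMap_smul]
      abel
    rw [e]
    simp only [LinearMap.sub_apply, LinearMap.comp_apply, LinearEquiv.coe_coe, mulX_apply]
    have h3 : Θ (c • (X ^ m : F[X]) • u) = c • Θ ((X ^ m : F[X]) • u) := map_smul _ _ _
    have h4 := hΘa ((X : F[X]) • x) _ hq
    rw [hΘa _ _ hp, h1, h2, map_add, h3, h4, smul_sub]
    abel
  refine (Submodule.rank_mono hle).trans ((rank_span_le _).trans ?_)
  simp

end Near

section CyclicSum

variable {F : Type*} [Field F]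

/-- The module with invariant factors `f 0, …, f (n - 1)`. -/
abbrev CyclicSum (n : ℕ) (f : ℕ → F[X]) : Type _ := (i : Fin n) → F[X] ⧸ Ideal.span {f i}

theorem finite_quotient_span {f : F[X]} (hf : f ≠ 0) :
    Module.Finite F (F[X] ⧸ Ideal.span {f}) :=
  (AdjoinRoot.powerBasis hf).finite

theorem finite_cyclicSum {n : ℕ} {f : ℕ → F[X]} (hf : ∀ i < n, f i ≠ 0) :
    Module.Finite F (CyclicSum n f) := by
  have : ∀ i : Fin n, Module.Finite F (F[X] ⧸ Ideal.span {f i}) := fun i =>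
    finite_quotient_span (hf i i.2)
  infer_instance

theorem finrank_cyclicSum {n : ℕ} {f : ℕ → F[X]} (hf : ∀ i < n, f i ≠ 0) :
    Module.finrank F (CyclicSum n f) = ∑ i ∈ Finset.range n, (f i).natDegree := by
  have : ∀ i : Fin n, Module.Finite F (F[X] ⧸ Ideal.span {f i}) := fun i =>
    finite_quotient_span (hf i i.2)
  rw [Module.finrank_pi_fintype, Finset.sum_range]
  exact Finset.sum_congr rfl fun i _ => finrank_quotient_span_eq_natDegree

/-- The `i`-th standard generator. -/
noncomputable def cyclicGen (n : ℕ) (f : ℕ → F[X]) (i : ℕ) : CyclicSum n f :=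
  if h : i < n then Pi.single ⟨i, h⟩ (Ideal.Quotient.mk _ 1) else 0

theorem smul_cyclicGen_eq_zero {n : ℕ} {f : ℕ → F[X]} {i : ℕ} {p : F[X]} (h : f i ∣ p) :
    p • cyclicGen n f i = 0 := by
  unfold cyclicGen
  split_ifs with hi
  · rw [← Pi.single_smul]
    have : p • (Ideal.Quotient.mk (Ideal.span {f i}) 1) = 0 := by
      rw [← Ideal.Quotient.mk_eq_mk, ← Submodule.Quotient.mk_smul, Ideal.Quotient.mk_eq_mk,
        Ideal.Quotient.eq_zero_iff_mem, smul_eq_mul, mul_one]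
      exact Ideal.mem_span_singleton.2 h
    rw [this, Pi.single_zero]
  · rw [smul_zero]

theorem mem_of_cyclicGen_mem {n : ℕ} {f : ℕ → F[X]} {S : Submodule F[X] (CyclicSum n f)}
    (h : ∀ i < n, cyclicGen n f i ∈ S) (x : CyclicSum n f) : x ∈ S := by
  rw [← Finset.univ_sum_single x]
  refine Submodule.sum_mem _ fun i _ => ?_
  obtain ⟨p, hp⟩ := Ideal.Quotient.mk_surjective (x i)
  have e : Pi.single i (x i) = p • cyclicGen n f i := by
    rw [cyclicGen, dif_pos i.2, ← Pi.single_smul, ← hp, ← Ideal.Quotient.mk_eq_mk,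
      ← Ideal.Quotient.mk_eq_mk, ← Submodule.Quotient.mk_smul, smul_eq_mul, mul_one]
  rw [e]
  exact S.smul_mem _ (h i i.2)

/-- The linear map from a cyclic sum determined by the images of the generators. -/
noncomputable def cyclicLift {n : ℕ} {g : ℕ → F[X]} {M : Type*} [AddCommGroup M] [Module F[X] M]
    (v : ℕ → M) (h : ∀ i < n, g i • v i = 0) : CyclicSum n g →ₗ[F[X]] M :=
  LinearMap.lsum F[X] _ F[X] fun i : Fin n =>
    Submodule.liftQSpanSingleton (g i) (LinearMap.toSpanSingleton F[X] M (v i))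
      (by simpa using h i i.2)

theorem cyclicLift_cyclicGen {n : ℕ} {g : ℕ → F[X]} {M : Type*} [AddCommGroup M] [Module F[X] M]
    {v : ℕ → M} (h : ∀ i < n, g i • v i = 0) {i : ℕ} (hi : i < n) :
    cyclicLift v h (cyclicGen n g i) = v i := by
  rw [cyclicLift, cyclicGen, dif_pos hi, LinearMap.lsum_piSingle]
  exact (Submodule.liftQSpanSingleton_apply _ _ _ _).trans (by simp)

theorem exists_bijective_coprodDegreeLT {k m : ℕ} {f g : ℕ → F[X]} (hf : ∀ i < k + 1, f i ≠ 0)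
    (hgf : ∀ i < k + 1, g i ∣ f i) (hfg : ∀ i < k, f i ∣ g (i + 1))
    (hm : ∑ i ∈ Finset.range (k + 1), (g i).natDegree + m
      = ∑ i ∈ Finset.range (k + 1), (f i).natDegree) :
    ∃ (ι : CyclicSum (k + 1) g →ₗ[F[X]] CyclicSum (k + 1) f) (u : CyclicSum (k + 1) f),
      Function.Bijective (coprodDegreeLT ι u m) := by
  have hg : ∀ i < k + 1, g i ≠ 0 := fun i hi => ne_zero_of_dvd_ne_zero (hf i hi) (hgf i hi)
  choose! ε hε using hgf
  have hε0 : ∀ i < k + 1, ε i ≠ 0 := fun i hi h => hf i hi (by rw [hε i hi, h, mul_zero])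
  set w := cyclicGen (k + 1) f
  set v : ℕ → CyclicSum (k + 1) f := fun i =>
    ε i • w i - if i = 0 then 0 else w (i - 1) with hv
  have hv0 : ∀ i < k + 1, g i • v i = 0 := by
    intro i hi
    simp only [hv]
    rw [smul_sub, smul_smul, ← hε i hi, smul_cyclicGen_eq_zero dvd_rfl, zero_sub, neg_eq_zero]
    split_ifs with h0
    · rw [smul_zero]
    · refine smul_cyclicGen_eq_zero ?_
      have := hfg (i - 1) (by omega)
      rwa [Nat.sub_add_cancel (by omega)] at this
  set ι := cyclicLift (n := k + 1) (g := g) v hv0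
  set S := LinearMap.range ι
  have hvS : ∀ i < k + 1, v i ∈ S := fun i hi => ⟨_, cyclicLift_cyclicGen hv0 hi⟩
  have hgen : ∀ x, x ∈ S ⊔ Submodule.span F[X] {w k} := by
    have key : ∀ d i, i + d = k → w i ∈ S ⊔ Submodule.span F[X] {w k} := by
      intro d
      induction d with
      | zero =>
        rintro i rfl
        exact Submodule.mem_sup_right (Submodule.mem_span_singleton_self _)
      | succ d ih =>
        intro i hi
        have h1 := Submodule.mem_sup_left (T := Submodule.span F[X] {w k}) (hvS (i + 1) (by omega))
        have h2 := Submodule.sub_mem _ (Submodule.smul_mem _ (ε (i + 1)) (ih (i + 1) (by omega))) h1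
        simpa [hv] using h2
    exact mem_of_cyclicGen_mem fun i hi => key (k - i) i (by omega)
  have hann : ∀ i < k + 1, (∏ j ∈ Finset.range (i + 1), ε j) • w i ∈ S := by
    intro i
    induction i with
    | zero =>
      intro hi
      simpa [hv] using hvS 0 hi
    | succ i ih =>
      intro hi
      have h1 := S.smul_mem (∏ j ∈ Finset.range (i + 1), ε j) (hvS (i + 1) hi)
      have h2 := S.add_mem h1 (ih (by omega))
      rw [Finset.prod_range_succ, mul_smul]
      simpa [hv, smul_sub] using h2
  set e := ∏ j ∈ Finset.range (k + 1), ε j with he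
  have he0 : e ≠ 0 := Finset.prod_ne_zero_iff.2 fun i hi => hε0 i (Finset.mem_range.1 hi)
  have hdeg : e.natDegree = m := by
    rw [he, natDegree_prod _ _ fun i hi => hε0 i (Finset.mem_range.1 hi)]
    have : ∑ i ∈ Finset.range (k + 1), (f i).natDegree
        = ∑ i ∈ Finset.range (k + 1), ((g i).natDegree + (ε i).natDegree) :=
      Finset.sum_congr rfl fun i hi => by
        have hi := Finset.mem_range.1 hi
        conv_lhs => rw [hε i hi]
        exact natDegree_mul (hg i hi) (hε0 i hi)
    rw [this, Finset.sum_add_distrib] at hm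
    omega
  have hsurj : Function.Surjective (coprodDegreeLT ι (w k) m) := by
    intro x
    obtain ⟨_, ⟨y, rfl⟩, _, hz, rfl⟩ := Submodule.mem_sup.1 (hgen x)
    obtain ⟨a, rfl⟩ := Submodule.mem_span_singleton.1 hz
    obtain ⟨y', hy'⟩ := S.smul_mem (a / e) (hann k (Nat.lt_succ_self k))
    refine ⟨(y + y', ⟨a % e, mem_degreeLT.2 ?_⟩), ?_⟩
    · rw [← hdeg, ← degree_eq_natDegree he0]
      exact EuclideanDomain.mod_lt a he0
    · have h1 : (a / e) • e • w k + (a % e) • w k = a • w k := by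
        rw [smul_smul, mul_comm]
        exact (add_smul _ _ _).symm.trans (by rw [EuclideanDomain.div_add_mod])
      rw [coprodDegreeLT_apply, map_add, hy', add_assoc]
      exact congrArg _ h1
  have := finite_cyclicSum hf
  have := finite_cyclicSum hg
  have : Module.Finite F (degreeLT F m) := Module.Finite.equiv (degreeLTEquiv F m).symm
  refine ⟨ι, w k, (LinearMap.injective_iff_surjective_of_finrank_eq_finrank ?_).2 hsurj, hsurj⟩
  rw [Module.finrank_prod, finrank_cyclicSum hf, finrank_cyclicSum hg,
    (degreeLTEquiv F m).finrank_eq, Module.finrank_fin_fun, hm]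

theorem near_cyclicSum_one {n : ℕ} {f g : ℕ → F[X]} (hf : IsFactorChain n f)
    (hg : IsFactorChain n g) (h : ShiftDvd n 1 f g) :
    Near 1 (mulX F (CyclicSum n f)) (mulX F (CyclicSum n g)) := by
  classical
  rcases n with _ | k
  · obtain ⟨Θ, hΘ⟩ := near_zero_of_linearEquiv (F := F)
      (LinearEquiv.piCongrRight fun i => i.elim0 : CyclicSum 0 f ≃ₗ[F[X]] CyclicSum 0 g)
    exact ⟨Θ, hΘ.trans (by simp)⟩
  · set γ : ℕ → F[X] := fun i => EuclideanDomain.gcd (f i) (g i)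
    have hle : ∑ i ∈ Finset.range (k + 1), (γ i).natDegree ≤ k + 1 := by
      conv_rhs => rw [← hf.sum_natDegree]
      exact Finset.sum_le_sum fun i hi => natDegree_le_of_dvd (EuclideanDomain.gcd_dvd_left _ _)
        (hf.ne_zero i (Finset.mem_range.1 hi))
    obtain ⟨m, hm⟩ := Nat.exists_eq_add_of_le hle
    obtain ⟨ι, u, hu⟩ := exists_bijective_coprodDegreeLT (g := γ) (m := m) hf.ne_zero
      (fun i _ => EuclideanDomain.gcd_dvd_left _ _)
      (fun i hi => EuclideanDomain.dvd_gcd (hf.chain i (by omega)) (h i (by omega)).1)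
      (by rw [hf.sum_natDegree, ← hm])
    obtain ⟨ι', u', hu'⟩ := exists_bijective_coprodDegreeLT (g := γ) (m := m) hg.ne_zero
      (fun i _ => EuclideanDomain.gcd_dvd_right _ _)
      (fun i hi => EuclideanDomain.dvd_gcd (h i (by omega)).2 (hg.chain i (by omega)))
      (by rw [hg.sum_natDegree, ← hm])
    exact near_one_of_bijective hu hu'

theorem near_cyclicSum {n r : ℕ} {f g : ℕ → F[X]} (hf : IsFactorChain n f)
    (hg : IsFactorChain n g) (h : ShiftDvd n r f g) :
    Near r (mulX F (CyclicSum n f)) (mulX F (CyclicSum n g)) := by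
  induction r generalizing f with
  | zero =>
    have e : ∀ i : Fin n, Ideal.span {f i} = Ideal.span {g i} := fun i =>
      Ideal.span_singleton_eq_span_singleton.2 (associated_of_dvd_dvd (h i i.2).1 (h i i.2).2)
    exact near_zero_of_linearEquiv
      (LinearEquiv.piCongrRight fun i => Submodule.quotEquivOfEq _ _ (e i))
  | succ r ih =>
    rcases Nat.eq_zero_or_pos r with rfl | hr
    · exact near_cyclicSum_one hf hg h
    · obtain ⟨χ, hχ, h1, h2⟩ := exists_intermediate_chain hf hg hr h
      exact (near_cyclicSum_one hf hχ h1).trans (ih hχ h2)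

end CyclicSum

section Cokernel

variable {F : Type*} [Field F] {n : ℕ}

theorem coeff_map_C_mulVec (A : Matrix (Fin n) (Fin n) F) (y : Fin n → F[X]) (k : ℕ) (i : Fin n) :
    ((A.map C *ᵥ y) i).coeff k = (A *ᵥ fun j => (y j).coeff k) i := by
  simp [mulVec, dotProduct, finsetSum_coeff]

theorem pencilOf_mulVec (A₀ A₁ : Matrix (Fin n) (Fin n) F) (y : Fin n → F[X]) :
    pencilOf A₀ A₁ *ᵥ y = A₀.map C *ᵥ y + (X : F[X]) • (A₁.map C *ᵥ y) := by
  rw [pencilOf, add_mulVec, smul_mulVec]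

theorem eq_zero_of_pencilOf_mulVec_eq {A₀ A₁ : Matrix (Fin n) (Fin n) F} (h : IsUnit A₁.det)
    {y : Fin n → F[X]} {c : Fin n → F} (hy : pencilOf A₀ A₁ *ᵥ y = fun i => C (c i)) : c = 0 := by
  have hinj : ∀ v, A₁ *ᵥ v = 0 → v = 0 := fun v hv => by
    rw [← one_mulVec v, ← nonsing_inv_mul A₁ h, ← mulVec_mulVec, hv, mulVec_zero]
  have hcoeff : ∀ k i, (A₀ *ᵥ fun j => (y j).coeff (k + 1)) i
      + (A₁ *ᵥ fun j => (y j).coeff k) i = 0 := fun k i => by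
    have := congrArg (fun p => p.coeff (k + 1)) (congrFun hy i)
    simpa [pencilOf_mulVec, coeff_map_C_mulVec, coeff_X_mul, coeff_C] using this
  have hstep : ∀ k, (fun j => (y j).coeff (k + 1)) = 0 → (fun j => (y j).coeff k) = 0 :=
    fun k hk => hinj _ (funext fun i => by simpa [hk] using hcoeff k i)
  obtain ⟨N, hN⟩ : ∃ N, (fun j => (y j).coeff N) = 0 :=
    ⟨Finset.univ.sup (fun j => (y j).natDegree) + 1, funext fun j =>
      coeff_eq_zero_of_natDegree_lt (Nat.lt_succ_of_le
        (Finset.le_sup (f := fun j => (y j).natDegree) (Finset.mem_univ j)))⟩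
  have h0 : (fun j => (y j).coeff 0) = 0 := by
    induction N with
    | zero => exact hN
    | succ N ih => exact ih (hstep N hN)
  funext i
  have := congrArg (fun p => p.coeff 0) (congrFun hy i)
  simpa [pencilOf_mulVec, coeff_map_C_mulVec, h0] using this.symm

theorem exists_linearEquiv_cyclicSum {A₀ A₁ : Matrix (Fin n) (Fin n) F} (h : IsUnit A₁.det)
    {f : ℕ → F[X]} (hf : IsSmithForm (pencilOf A₀ A₁) f) :
    ∃ T : (Fin n → F) ≃ₗ[F] CyclicSum n f,
      ∀ v, T ((-(A₁⁻¹ * A₀)) *ᵥ v) = (X : F[X]) • T v := by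
  obtain ⟨U, V, hU, hV, hUV⟩ := hf.equiv
  let E : (Fin n → F) →ₗ[F] (Fin n → F[X]) :=
    (Algebra.linearMap F F[X]).compLeft (Fin n)
  let mk : (Fin n → F[X]) →ₗ[F[X]] CyclicSum n f :=
    LinearMap.piMap fun i => Submodule.mkQ (Ideal.span {f i})
  have hmk : ∀ y, mk y = 0 ↔ ∃ z, y = (diagonal fun i : Fin n => f i) *ᵥ z := by
    intro y
    have h1 : mk y = 0 ↔ ∀ i : Fin n, f i ∣ y i := by
      rw [funext_iff]
      refine forall_congr' fun i => ?_
      exact (Submodule.Quotient.mk_eq_zero _).trans Ideal.mem_span_singleton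
    rw [h1]
    constructor
    · intro hy
      choose z hz using hy
      exact ⟨z, funext fun i => by rw [mulVec_diagonal, hz]⟩
    · rintro ⟨z, rfl⟩ i
      rw [mulVec_diagonal]
      exact dvd_mul_right _ _
  let T : (Fin n → F) →ₗ[F] CyclicSum n f :=
    (mk.restrictScalars F) ∘ₗ (U.mulVecLin.restrictScalars F) ∘ₗ E ∘ₗ A₁.mulVecLin
  have hT : ∀ v, T v = mk (U *ᵥ fun i => C ((A₁ *ᵥ v) i)) := fun v => rfl
  have hUM : U * pencilOf A₀ A₁ = (diagonal fun i : Fin n => f i) * V⁻¹ := by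
    rw [← hUV, mul_assoc, mul_nonsing_inv V hV, mul_one]
  have hinj : Function.Injective T := by
    refine (injective_iff_map_eq_zero T).2 fun v hv => ?_
    obtain ⟨z, hz⟩ := (hmk _).1 ((hT v).symm.trans hv)
    have h1 : pencilOf A₀ A₁ *ᵥ (V *ᵥ z) = fun i => C ((A₁ *ᵥ v) i) := by
      rw [← hUV, ← mulVec_mulVec, ← mulVec_mulVec] at hz
      have := congrArg (U⁻¹ *ᵥ ·) hz
      simpa only [mulVec_mulVec, ← mul_assoc, nonsing_inv_mul U hU, one_mul, one_mulVec]
        using this.symm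
    have h2 := eq_zero_of_pencilOf_mulVec_eq h h1
    rw [← one_mulVec v, ← nonsing_inv_mul A₁ h, ← mulVec_mulVec, h2, mulVec_zero]
  have := finite_cyclicSum hf.ne_zero
  refine ⟨LinearEquiv.ofInjectiveOfFinrankEq T hinj (by
    rw [finrank_cyclicSum hf.ne_zero, hf.sum_natDegree, Module.finrank_fin_fun]), fun v => ?_⟩
  change T _ = (X : F[X]) • T v
  rw [hT, hT, ← map_smul, ← sub_eq_zero, ← map_sub, hmk]
  refine ⟨V⁻¹ *ᵥ -fun i => C (v i), ?_⟩
  have hA : A₁ *ᵥ ((-(A₁⁻¹ * A₀)) *ᵥ v) = -(A₀ *ᵥ v) := by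
    rw [neg_mulVec, mulVec_neg, mulVec_mulVec, ← mul_assoc, mul_nonsing_inv A₁ h, one_mul]
  have hC : ∀ (A : Matrix (Fin n) (Fin n) F) (w : Fin n → F),
      (A.map C *ᵥ fun i => C (w i)) = fun i => C ((A *ᵥ w) i) := fun A w =>
    funext fun i => (RingHom.map_mulVec C A w i).symm
  rw [mulVec_mulVec _ _ V⁻¹, ← hUM, ← mulVec_mulVec, mulVec_neg, pencilOf_mulVec, hC, hC, hA,
    ← mulVec_smul, ← mulVec_sub]
  congr 1
  funext i
  simp only [Pi.sub_apply, Pi.smul_apply, Pi.neg_apply, Pi.add_apply, map_neg]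
  ring

end Cokernel

section LowRank

universe v

variable {F : Type v} [Field F] {n : ℕ}

theorem near_pencil {r : ℕ} {A₀ A₁ B₀ B₁ : Matrix (Fin n) (Fin n) F} (hA : IsUnit A₁.det)
    (hB : IsUnit B₁.det) {f g : ℕ → F[X]} (hf : IsSmithForm (pencilOf A₀ A₁) f)
    (hg : IsSmithForm (pencilOf B₀ B₁) g) (h : ShiftDvd n r f g) :
    Near r (toLin' (-(A₁⁻¹ * A₀))) (toLin' (-(B₁⁻¹ * B₀))) := by
  obtain ⟨T, hT⟩ := exists_linearEquiv_cyclicSum hA hf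
  obtain ⟨T', hT'⟩ := exists_linearEquiv_cyclicSum hB hg
  have h1 := near_zero_of_semiconj (T := toLin' (-(A₁⁻¹ * A₀))) (T' := mulX F (CyclicSum n f)) T
    fun v => hT v
  have h2 := near_zero_of_semiconj (T' := toLin' (-(B₁⁻¹ * B₀))) (T := mulX F (CyclicSum n g))
    T'.symm fun v => T'.injective ((T'.apply_symm_apply _).trans
      ((congrArg _ (T'.apply_symm_apply v)).symm.trans (hT' (T'.symm v)).symm))
  simpa using (h1.trans (near_cyclicSum hf.toIsFactorChain hg.toIsFactorChain h)).trans h2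

theorem exists_rank_le {r : ℕ} {A₀ A₁ B₀ B₁ : Matrix (Fin n) (Fin n) F} (hA : IsUnit A₁.det)
    (hB : IsUnit B₁.det) {f g : ℕ → F[X]} (hf : IsSmithForm (pencilOf A₀ A₁) f)
    (hg : IsSmithForm (pencilOf B₀ B₁) g) (h : ShiftDvd n r f g) :
    ∃ Q R : Matrix (Fin n) (Fin n) F, IsUnit Q.det ∧ IsUnit R.det ∧ Q * B₁ * R = A₁ ∧
      (Q * B₀ * R - A₀).rank ≤ r := by
  obtain ⟨Θ, hΘ⟩ := near_pencil hA hB hf hg h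
  set S := LinearMap.toMatrix' Θ.toLinearMap with hSdef
  have hS : IsUnit S.det := by
    rw [hSdef, LinearMap.det_toMatrix']
    exact Θ.isUnit_det'
  have hrank : (S * -(A₁⁻¹ * A₀) - -(B₁⁻¹ * B₀) * S).rank ≤ r := by
    have e : Θ.toLinearMap = toLin' S := (toLin'_toMatrix' _).symm
    rw [e, ← toLin'_mul, ← toLin'_mul, ← map_sub] at hΘ
    exact Module.finrank_le_of_rank_le hΘ
  have hSi : IsUnit (S⁻¹).det := isUnit_nonsing_inv_det S hS
  have hBi : IsUnit (B₁⁻¹).det := isUnit_nonsing_inv_det B₁ hB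
  have hAi : IsUnit (A₁⁻¹).det := isUnit_nonsing_inv_det A₁ hA
  refine ⟨A₁ * S⁻¹ * B₁⁻¹, S, by simpa only [det_mul] using (hA.mul hSi).mul hBi, hS, ?_, ?_⟩
  · rw [mul_assoc _ B₁⁻¹, nonsing_inv_mul B₁ hB, mul_one, mul_assoc, nonsing_inv_mul S hS, mul_one]
  · rw [← rank_mul_eq_right_of_isUnit_det (S * A₁⁻¹) _ (by
      rw [det_mul]; exact hS.mul hAi)]
    have e : S * A₁⁻¹ * (A₁ * S⁻¹ * B₁⁻¹ * B₀ * S) = B₁⁻¹ * B₀ * S := by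
      calc _ = S * (A₁⁻¹ * A₁) * S⁻¹ * B₁⁻¹ * B₀ * S := by simp only [mul_assoc]
        _ = _ := by rw [nonsing_inv_mul A₁ hA, mul_one, mul_nonsing_inv S hS, one_mul]
    have e' : S * A₁⁻¹ * (A₁ * S⁻¹ * B₁⁻¹ * B₀ * S - A₀)
        = S * -(A₁⁻¹ * A₀) - -(B₁⁻¹ * B₀) * S := by
      rw [mul_sub, e, mul_neg, neg_mul, mul_assoc S]
      abel
    rwa [e']

end LowRank

section RankOneSteps

variable {F : Type*} [Field F] {n : ℕ}

/-- `N'` is invertible and differs from `N` by a matrix of rank at most one. -/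
def RankOneStep (N N' : Matrix (Fin n) (Fin n) F) : Prop :=
  IsUnit N'.det ∧ (N' - N).rank ≤ 1

theorem rank_single_mul_le (i j : Fin n) (c : F) (N : Matrix (Fin n) (Fin n) F) :
    (single i j c * N).rank ≤ 1 := by
  have : single i j c = vecMulVec (Pi.single i c) (Pi.single j 1) := by
    ext a b
    simp [single_apply, vecMulVec_apply, Pi.single_apply, ite_and, eq_comm]
    split_ifs <;> rfl
  exact (rank_mul_le_left _ _).trans (this ▸ rank_vecMulVec_le _ _)

theorem reflTransGen_diagonal_mul {d : Fin n → F} (hd : ∀ i, d i ≠ 0)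
    {N : Matrix (Fin n) (Fin n) F} (hN : IsUnit N.det) (s : Finset (Fin n)) :
    Relation.ReflTransGen RankOneStep N (diagonal (fun i => if i ∈ s then d i else 1) * N) := by
  induction s using Finset.induction_on with
  | empty => simpa using Relation.ReflTransGen.refl
  | insert a s ha ih =>
    refine ih.tail ⟨?_, ?_⟩
    · rw [det_mul, det_diagonal]
      refine (IsUnit.mk0 _ (Finset.prod_ne_zero_iff.2 fun i _ => ?_)).mul hN
      split_ifs
      · exact hd i
      · exact one_ne_zero
    · have : diagonal (fun i => if i ∈ insert a s then d i else 1)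
          - diagonal (fun i => if i ∈ s then d i else 1) = single a a (d a - 1) := by
        rw [diagonal_sub, ← diagonal_single]
        congr 1
        funext i
        rcases eq_or_ne i a with rfl | hi
        · simp [ha]
        · simp [hi]
      rw [← sub_mul, this]
      exact rank_single_mul_le _ _ _ _

theorem reflTransGen_mul {M N : Matrix (Fin n) (Fin n) F} (hM : IsUnit M.det)
    (hN : IsUnit N.det) : Relation.ReflTransGen RankOneStep N (M * N) := by
  refine diagonal_transvection_induction_of_det_ne_zero
    (fun M => ∀ N : Matrix (Fin n) (Fin n) F, IsUnit N.det →
      Relation.ReflTransGen RankOneStep N (M * N)) M hM.ne_zero ?_ ?_ ?_ N hN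
  · intro d hd N hN
    rw [det_diagonal, Finset.prod_ne_zero_iff] at hd
    simpa using reflTransGen_diagonal_mul (fun i => hd i (Finset.mem_univ i)) hN Finset.univ
  · intro t N hN
    refine .single ⟨?_, ?_⟩
    · rw [det_mul, TransvectionStruct.det, one_mul]
      exact hN
    · rw [TransvectionStruct.toMatrix, transvection, add_mul, one_mul, add_sub_cancel_left]
      exact rank_single_mul_le _ _ _ _
  · intro A B _ hB ihA ihB N hN
    rw [mul_assoc]
    refine (ihB N hN).trans (ihA _ ?_)
    rw [det_mul]
    exact (IsUnit.mk0 _ hB).mul hN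

theorem exists_eq_of_reflTransGen {α : Type*} {step : α → α → Prop} {d : α → ℕ}
    (hd : ∀ x y, step x y → d y ≤ d x + 1) {a b : α} (h : Relation.ReflTransGen step a b) {r : ℕ}
    (ha : d a ≤ r) (hb : r ≤ d b) : ∃ c, Relation.ReflTransGen step a c ∧ d c = r := by
  induction h using Relation.ReflTransGen.head_induction_on with
  | refl => exact ⟨b, .refl, le_antisymm ha hb⟩
  | head h _ ih =>
    rcases ha.eq_or_lt with ha | ha
    · exact ⟨_, .refl, ha⟩
    · obtain ⟨x, hx, hxr⟩ := ih ((hd _ _ h).trans ha)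
      exact ⟨x, .head h hx, hxr⟩

theorem exists_isUnit_det_sub_one (hn : 2 ≤ n) :
    ∃ G : Matrix (Fin n) (Fin n) F, IsUnit G.det ∧ IsUnit (G - 1).det := by
  set p : F[X] := X ^ n + (-X + 1) with hp
  have hlow : (-X + 1 : F[X]).degree < n := by
    have : (-X + 1 : F[X]).degree ≤ 1 := by compute_degree
    exact this.trans_lt (by exact_mod_cast hn)
  have hmonic : p.Monic := monic_X_pow_add hlow
  have hdeg : p.natDegree = n := by
    rw [hp, natDegree_add_eq_left_of_degree_lt (by rwa [degree_X_pow]), natDegree_X_pow]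
  set x := AdjoinRoot.root p
  have hx : x ^ n + (-x + 1) = 0 := by
    have := AdjoinRoot.mk_self (f := p)
    simpa [hp] using this
  let b : Module.Basis (Fin n) F (AdjoinRoot p) :=
    (AdjoinRoot.powerBasis' hmonic).basis.reindex (finCongr hdeg)
  have hx' : x * (x ^ (n - 1) - 1) = -1 := by
    obtain ⟨m, rfl⟩ : ∃ m, n = m + 1 := ⟨n - 1, by omega⟩
    rw [Nat.add_sub_cancel, mul_sub, ← pow_succ']
    linear_combination hx
  have h1 : IsUnit x := isUnit_of_dvd_unit ⟨_, hx'.symm⟩ isUnit_one.neg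
  have h2 : IsUnit (x - 1) := isUnit_of_dvd_unit
    ((sub_one_dvd_pow_sub_one x (n - 1)).trans ⟨_, (mul_comm _ x ▸ hx').symm⟩) isUnit_one.neg
  refine ⟨Algebra.leftMulMatrix b x, ?_, ?_⟩
  · exact (isUnit_iff_isUnit_det _).1 (h1.map _)
  · rw [← map_one (Algebra.leftMulMatrix b), ← map_sub]
    exact (isUnit_iff_isUnit_det _).1 (h2.map _)

end RankOneSteps

section NormalRank

variable {F : Type*} [Field F] {n : ℕ}

theorem normalRank_add_le (M N : Matrix (Fin n) (Fin n) F[X]) :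
    normalRank (M + N) ≤ normalRank M + normalRank N := by
  rw [normalRank, Matrix.map_add _ (map_add _)]
  exact rank_add_le' _ _

theorem normalRank_mul_le_left (M N : Matrix (Fin n) (Fin n) F[X]) :
    normalRank (M * N) ≤ normalRank M := by
  rw [normalRank, Matrix.map_mul]
  exact rank_mul_le_left _ _

theorem normalRank_mul_le_right (M N : Matrix (Fin n) (Fin n) F[X]) :
    normalRank (M * N) ≤ normalRank N := by
  rw [normalRank, Matrix.map_mul]
  exact rank_mul_le_right _ _

theorem normalRank_neg (M : Matrix (Fin n) (Fin n) F[X]) : normalRank (-M) = normalRank M := by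
  rw [normalRank, normalRank, ← rank_neg', Matrix.map_neg _ (map_neg _), neg_neg]

theorem normalRank_map_C (M : Matrix (Fin n) (Fin n) F) : normalRank (M.map C) = M.rank := by
  rw [normalRank, Matrix.map_map]
  exact rank_map_ringHom ((algebraMap F[X] (RatFunc F)).comp C) M

theorem normalRank_le (M : Matrix (Fin n) (Fin n) F[X]) : normalRank M ≤ n :=
  rank_le_width _

theorem normalRank_eq_of_det_ne_zero {M : Matrix (Fin n) (Fin n) F[X]} (h : M.det ≠ 0) :
    normalRank M = n := by
  have : (M.map (algebraMap F[X] (RatFunc F))).det ≠ 0 := by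
    rw [← RingHom.mapMatrix_apply, ← RingHom.map_det]
    exact (map_ne_zero_iff _ (IsFractionRing.injective _ _)).2 h
  rw [normalRank, rank_of_isUnit _ ((isUnit_iff_isUnit_det _).2 (IsUnit.mk0 _ this)),
    Fintype.card_fin]

theorem dvd_of_normalRank_le {r : ℕ} {M N X Y : Matrix (Fin n) (Fin n) F[X]} {f g : ℕ → F[X]}
    (hf : IsSmithForm M f) (hg : IsSmithForm N g) (hX : IsUnit X.det) (hY : IsUnit Y.det)
    (hr : normalRank (X * N * Y - M) ≤ r) {i : ℕ} (hi : i + r < n) : f i ∣ g (i + r) := by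
  obtain ⟨U, V, hU, hV, hUV⟩ := hf.equiv
  obtain ⟨U', V', hU', hV', hUV'⟩ := hg.equiv.symm
  refine dvd_of_rank_le (K := RatFunc F) hf.chain hg.chain hf.ne_zero hg.ne_zero
    (X := U * X * U') (Y := V' * Y * V) ?_ ?_ ?_ i hi
  · simpa only [det_mul] using (hU.mul hX).mul hU'
  · simpa only [det_mul] using (hV'.mul hY).mul hV
  · have e : U * X * U' * (diagonal fun i : Fin n => g i) * (V' * Y * V)
        - (diagonal fun i : Fin n => f i) = U * (X * N * Y - M) * V := by
      rw [← hUV, ← hUV', mul_sub, sub_mul]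
      simp only [mul_assoc]
    rw [e]
    exact (normalRank_mul_le_left _ _).trans ((normalRank_mul_le_right _ _).trans hr)

end NormalRank

section Core

variable {F : Type*} [Field F] {n : ℕ}

theorem pencilOf_mul_sub (A₀ A₁ B₀ B₁ Q R : Matrix (Fin n) (Fin n) F) :
    pencilOf (Q * B₀ * R - A₀) (Q * B₁ * R - A₁)
      = Q.map C * pencilOf B₀ B₁ * R.map C - pencilOf A₀ A₁ := by
  simp only [pencilOf, Matrix.map_sub _ (map_sub C), Matrix.map_mul, mul_add, add_mul, smul_sub,
    Matrix.mul_smul, Matrix.smul_mul]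
  abel

theorem isUnit_det_map_C {Q : Matrix (Fin n) (Fin n) F} (hQ : IsUnit Q.det) :
    IsUnit (Q.map C).det := by
  rw [← RingHom.mapMatrix_apply, ← RingHom.map_det]
  exact hQ.map C

theorem exists_normalRank_eq {r : ℕ} (hn : 2 ≤ n) {A₀ A₁ B₀ B₁ : Matrix (Fin n) (Fin n) F}
    (hA : IsUnit A₁.det) (hB : IsUnit B₁.det) {f g : ℕ → F[X]}
    (hf : IsSmithForm (pencilOf A₀ A₁) f) (hg : IsSmithForm (pencilOf B₀ B₁) g)
    (h : ShiftDvd n r f g) (hr : r ≤ n) :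
    ∃ Q R : Matrix (Fin n) (Fin n) F, IsUnit Q.det ∧ IsUnit R.det ∧
      normalRank (pencilOf (Q * B₀ * R - A₀) (Q * B₁ * R - A₁)) = r := by
  obtain ⟨Q, R, hQ, hR, hQR, hrank⟩ := exists_rank_le hA hB hf hg h
  obtain ⟨G, hG, hG1⟩ := exists_isUnit_det_sub_one (F := F) hn
  set d : Matrix (Fin n) (Fin n) F → ℕ := fun Q =>
    normalRank (pencilOf (Q * B₀ * R - A₀) (Q * B₁ * R - A₁)) with hd
  have hstep : ∀ Q Q', RankOneStep Q Q' → d Q' ≤ d Q + 1 := by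
    intro Q Q' h
    have e : pencilOf (Q' * B₀ * R - A₀) (Q' * B₁ * R - A₁)
        = pencilOf (Q * B₀ * R - A₀) (Q * B₁ * R - A₁)
          + (Q' - Q).map C * (pencilOf B₀ B₁ * R.map C) := by
      rw [pencilOf_mul_sub, pencilOf_mul_sub, Matrix.map_sub _ (map_sub C), sub_mul,
        ← mul_assoc, ← mul_assoc]
      abel
    simp only [hd]
    rw [e]
    refine (normalRank_add_le _ _).trans (Nat.add_le_add_left ?_ _)
    exact (normalRank_mul_le_left _ _).trans ((normalRank_map_C _).trans_le h.2)
  have h0 : d Q ≤ r := by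
    have e : pencilOf (Q * B₀ * R - A₀) (Q * B₁ * R - A₁) = (Q * B₀ * R - A₀).map C := by
      rw [hQR, sub_self, pencilOf, Matrix.map_zero _ (map_zero C), smul_zero, add_zero]
    simp only [hd]
    rwa [e, normalRank_map_C]
  have h1 : d (G * Q) = n := by
    refine normalRank_eq_of_det_ne_zero (det_pencilOf_ne_zero ?_)
    have e : G * Q * B₁ * R - A₁ = (G - 1) * A₁ := by
      rw [sub_mul, one_mul, ← hQR]
      simp only [mul_assoc]
    rw [e, det_mul]
    exact hG1.mul hA
  obtain ⟨Q', hQ', hr'⟩ := exists_eq_of_reflTransGen hstep (reflTransGen_mul hG hQ) h0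
    (hr.trans_eq h1.symm)
  refine ⟨Q', R, ?_, hR, hr'⟩
  rcases Relation.ReflTransGen.cases_tail hQ' with rfl | ⟨_, _, h⟩
  · exact hQ
  · exact h.1

theorem shiftDvd_of_normalRank_le {r : ℕ} {M N X Y : Matrix (Fin n) (Fin n) F[X]} {f g : ℕ → F[X]}
    (hf : IsSmithForm M f) (hg : IsSmithForm N g) (hX : IsUnit X.det) (hY : IsUnit Y.det)
    (hr : normalRank (X * N * Y - M) ≤ r) : ShiftDvd n r f g := by
  intro i hi
  refine ⟨dvd_of_normalRank_le hf hg hX hY hr hi, dvd_of_normalRank_le hg hf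
    (isUnit_nonsing_inv_det X hX) (isUnit_nonsing_inv_det Y hY) ?_ hi⟩
  have e : X⁻¹ * M * Y⁻¹ - N = X⁻¹ * -(X * N * Y - M) * Y⁻¹ := by
    have h1 : X⁻¹ * (X * N * Y) * Y⁻¹ = N := by
      calc _ = X⁻¹ * X * N * (Y * Y⁻¹) := by simp only [mul_assoc]
        _ = N := by rw [nonsing_inv_mul X hX, mul_nonsing_inv Y hY, one_mul, mul_one]
    rw [neg_sub, mul_sub, sub_mul, h1]
  rw [e]
  refine (normalRank_mul_le_left _ _).trans ((normalRank_mul_le_right _ _).trans ?_)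
  rwa [normalRank_neg]

/-- The perturbation theorem for pencils without infinite eigenvalue, with perturbations given
by the transforming matrices. -/
theorem exists_normalRank_eq_iff (hn : 2 ≤ n) {A₀ A₁ B₀ B₁ : Matrix (Fin n) (Fin n) F}
    (hA : IsUnit A₁.det) (hB : IsUnit B₁.det) {φ ψ : ℕ → MvPolynomial (Fin 2) F}
    (hφ : IsHomogeneousIF A₀ A₁ φ) (hψ : IsHomogeneousIF B₀ B₁ ψ) (r : ℕ) :
    (∃ Q R : Matrix (Fin n) (Fin n) F, IsUnit Q.det ∧ IsUnit R.det ∧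
      normalRank (pencilOf (Q * B₀ * R - A₀) (Q * B₁ * R - A₁)) = r) ↔
      sInf {r' : ℕ | Interlace n r' φ ψ} ≤ r ∧ r ≤ n := by
  obtain ⟨f, hf⟩ := exists_isSmithForm (G₀ := A₀) hA
  obtain ⟨g, hg⟩ := exists_isSmithForm (G₀ := B₀) hB
  have hset : {r' : ℕ | Interlace n r' φ ψ} = {r' | ShiftDvd n r' f g} :=
    Set.ext fun r' => interlace_iff_of_isSmithForm hA hB hφ hψ hf hg
  rw [hset, sInf_shiftDvd_le_iff hf.chain hg.chain]
  constructor
  · rintro ⟨Q, R, hQ, hR, rfl⟩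
    refine ⟨shiftDvd_of_normalRank_le hf hg (isUnit_det_map_C hQ) (isUnit_det_map_C hR) ?_,
      normalRank_le _⟩
    rw [pencilOf_mul_sub]
  · rintro ⟨h, hr⟩
    exact exists_normalRank_eq hn hA hB hf hg h hr

end Core

section Exchange

variable {F : Type*} [Field F] {n : ℕ}

theorem transcendental_add_inv_X (c : F) :
    Transcendental F (algebraMap F (RatFunc F) c + (RatFunc.X : RatFunc F)⁻¹) := by
  intro h
  refine RatFunc.transcendental_X (K := F) ?_
  have := (h.sub (isAlgebraic_algebraMap c)).inv
  rwa [add_sub_cancel_left, inv_inv] at this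

theorem normalRank_pencilOf_exchange (c : F) (P₀ P₁ : Matrix (Fin n) (Fin n) F) :
    normalRank (pencilOf P₁ (P₀ + c • P₁)) = normalRank (pencilOf P₀ P₁) := by
  let h : RatFunc F →+* RatFunc F := IsFractionRing.lift (A := F[X])
    (g := (aeval (algebraMap F (RatFunc F) c + (RatFunc.X : RatFunc F)⁻¹)).toRingHom)
    (transcendental_iff_injective.1 (transcendental_add_inv_X c))
  have hX : (RatFunc.X : RatFunc F) ≠ 0 := RatFunc.X_ne_zero
  have hh (p : F[X]) : h (algebraMap F[X] (RatFunc F) p)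
      = aeval (algebraMap F (RatFunc F) c + (RatFunc.X : RatFunc F)⁻¹) p :=
    IsFractionRing.lift_algebraMap _ _
  have e : (pencilOf P₁ (P₀ + c • P₁)).map (algebraMap F[X] (RatFunc F))
      = (RatFunc.X : RatFunc F) •
        ((pencilOf P₀ P₁).map (algebraMap F[X] (RatFunc F))).map h := by
    ext i j
    simp only [map_apply, Matrix.smul_apply, smul_eq_mul, hh]
    simp only [pencilOf, map_apply, Matrix.smul_apply, Matrix.add_apply, smul_eq_mul, map_add,
      map_mul, aeval_C, aeval_X, RatFunc.algebraMap_X, RatFunc.algebraMap_C,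
      ← RatFunc.algebraMap_eq_C]
    field_simp
    ring
  rw [normalRank, normalRank, e, rank_smul_of_mem_nonZeroDivisors _
    (mem_nonZeroDivisors_of_ne_zero hX), rank_map_ringHom]

/-- The substitution `(s, t) ↦ (c s + t, s)`. -/
noncomputable def exchange (c : F) : MvPolynomial (Fin 2) F ≃ₐ[F] MvPolynomial (Fin 2) F :=
  AlgEquiv.ofAlgHom
    (MvPolynomial.aeval
      ![MvPolynomial.C c * MvPolynomial.X 0 + MvPolynomial.X 1, MvPolynomial.X 0])
    (MvPolynomial.aeval
      ![MvPolynomial.X 1, MvPolynomial.X 0 - MvPolynomial.C c * MvPolynomial.X 1])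
    (by ext i; fin_cases i <;> simp [MvPolynomial.algebraMap_eq])
    (by ext i; fin_cases i <;> simp [MvPolynomial.algebraMap_eq])

theorem map_homPencil_exchange (c : F) (G₀ G₁ : Matrix (Fin n) (Fin n) F) :
    (homPencil G₀ G₁).map (exchange c) = homPencil G₁ (G₀ + c • G₁) := by
  ext1 i j
  simp [homPencil, exchange, MvPolynomial.algebraMap_eq]
  ring

theorem isGCDOf_image {R S : Type*} [CommRing R] [CommRing S] (e : R ≃+* S) {g : R} {s : Set R}
    (h : IsGCDOf g s) : IsGCDOf (e g) (e '' s) := by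
  refine ⟨?_, fun d hd => ?_⟩
  · rintro _ ⟨x, hx, rfl⟩
    exact map_dvd e (h.1 x hx)
  · rw [← e.apply_symm_apply d, map_dvd_iff]
    refine h.2 _ fun x hx => ?_
    rw [← map_dvd_iff e, e.apply_symm_apply]
    exact hd _ ⟨x, hx, rfl⟩

theorem isHomogeneousIF_exchange (c : F) {G₀ G₁ : Matrix (Fin n) (Fin n) F}
    {φ : ℕ → MvPolynomial (Fin 2) F} (h : IsHomogeneousIF G₀ G₁ φ) :
    IsHomogeneousIF G₁ (G₀ + c • G₁) fun i => exchange c (φ i) := by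
  intro k hk
  have := isGCDOf_image (exchange c).toRingEquiv (h k hk)
  rw [← map_homPencil_exchange]
  convert this using 1
  · exact (map_prod (exchange c) _ _).symm
  · exact minorsSet_map (exchange c).toRingEquiv.toRingHom _ _

theorem interlace_exchange (c : F) {r : ℕ} {φ ψ : ℕ → MvPolynomial (Fin 2) F} :
    Interlace n r (fun i => exchange c (φ i)) (fun i => exchange c (ψ i)) ↔
      Interlace n r φ ψ := by
  simp only [interlace_iff_shiftDvd, ShiftDvd, map_dvd_iff]

end Exchange

section StrictEquiv

variable {F : Type*} [Field F] {n : ℕ}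

theorem isPencil_pencilOf (G₀ G₁ : Matrix (Fin n) (Fin n) F) : IsPencil (pencilOf G₀ G₁) := by
  intro i j
  simp only [pencilOf, Matrix.add_apply, Matrix.smul_apply, map_apply, smul_eq_mul]
  compute_degree

theorem exists_isPencil_iff {A₀ A₁ B₀ B₁ : Matrix (Fin n) (Fin n) F} {r : ℕ} :
    (∃ P : Matrix (Fin n) (Fin n) F[X], IsPencil P ∧ normalRank P = r ∧
        StrictEquiv (pencilOf A₀ A₁ + P) (pencilOf B₀ B₁)) ↔
      ∃ Q R : Matrix (Fin n) (Fin n) F, IsUnit Q.det ∧ IsUnit R.det ∧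
        normalRank (pencilOf (Q * B₀ * R - A₀) (Q * B₁ * R - A₁)) = r := by
  constructor
  · rintro ⟨P, -, hr, Q, R, hQ, hR, h⟩
    refine ⟨Q, R, hQ, hR, ?_⟩
    rwa [pencilOf_mul_sub, ← h, add_sub_cancel_left]
  · rintro ⟨Q, R, hQ, hR, hr⟩
    refine ⟨_, isPencil_pencilOf _ _, hr, Q, R, hQ, hR, ?_⟩
    rw [pencilOf_mul_sub, add_sub_cancel]

theorem exists_normalRank_eq_iff_of_isUnit_add (hn : 2 ≤ n) {c : F}
    {A₀ A₁ B₀ B₁ : Matrix (Fin n) (Fin n) F} (hA : IsUnit (A₀ + c • A₁).det)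
    (hB : IsUnit (B₀ + c • B₁).det) {φ ψ : ℕ → MvPolynomial (Fin 2) F}
    (hφ : IsHomogeneousIF A₀ A₁ φ) (hψ : IsHomogeneousIF B₀ B₁ ψ) (r : ℕ) :
    (∃ Q R : Matrix (Fin n) (Fin n) F, IsUnit Q.det ∧ IsUnit R.det ∧
      normalRank (pencilOf (Q * B₀ * R - A₀) (Q * B₁ * R - A₁)) = r) ↔
      sInf {r' : ℕ | Interlace n r' φ ψ} ≤ r ∧ r ≤ n := by
  have h := exists_normalRank_eq_iff hn hA hB (isHomogeneousIF_exchange c hφ)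
    (isHomogeneousIF_exchange c hψ) r
  simp only [interlace_exchange] at h
  rw [← h]
  refine exists_congr fun Q => exists_congr fun R => ?_
  have e : Q * (B₀ + c • B₁) * R - (A₀ + c • A₁)
      = (Q * B₀ * R - A₀) + c • (Q * B₁ * R - A₁) := by
    simp only [mul_add, add_mul, smul_sub, Matrix.mul_smul, Matrix.smul_mul]
    abel
  rw [e, normalRank_pencilOf_exchange]

end StrictEquiv

end PencilPerturbation

/-- With the hypotheses of the main theorem, a pencil of normal rank exactly
`r` taking `A(s)` to `B(s)` exists iff `r₀ ≤ r ≤ n`, where `r₀` is the least `r` for which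
the interlacing conditions hold. -/
theorem stmt15 (F : Type*) [Field F] (n : ℕ) (hn : 2 ≤ n)
    (A₀ A₁ B₀ B₁ : Matrix (Fin n) (Fin n) F)
    (hA : (pencilOf A₀ A₁).det ≠ 0) (hB : (pencilOf B₀ B₁).det ≠ 0)
    (φ ψ : ℕ → MvPolynomial (Fin 2) F)
    (hφ : IsHomogeneousIF A₀ A₁ φ) (hφc : ∀ i, i + 1 < n → φ i ∣ φ (i + 1))
    (hψ : IsHomogeneousIF B₀ B₁ ψ) (hψc : ∀ i, i + 1 < n → ψ i ∣ ψ (i + 1))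
    (hc : (∃ c : F, IsUnit (A₀ + c • A₁).det ∧ IsUnit (B₀ + c • B₁).det) ∨
      (IsUnit A₁.det ∧ IsUnit B₁.det))
    (r : ℕ) :
    (∃ P : Matrix (Fin n) (Fin n) (Polynomial F), IsPencil P ∧ normalRank P = r ∧
        StrictEquiv (pencilOf A₀ A₁ + P) (pencilOf B₀ B₁)) ↔
      (sInf {r' : ℕ | Interlace n r' φ ψ} ≤ r ∧ r ≤ n) := by
  rw [PencilPerturbation.exists_isPencil_iff]
  rcases hc with ⟨c, hcA, hcB⟩ | ⟨hA₁, hB₁⟩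
  · exact PencilPerturbation.exists_normalRank_eq_iff_of_isUnit_add hn hcA hcB hφ hψ r
  · exact PencilPerturbation.exists_normalRank_eq_iff hn hA₁ hB₁ hφ hψ r
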